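/- For every integer q ≥ 2, the smallest accumulation point m̃_q of L̃_q ⊆ ℝ satisfies m̃_q = π_q(m^abs_{≤_lex}) = π_q(ρ_2(m_alt)), where m_alt is the smallest accumulation point of M_{≤_alt} on {0,1}^∞; moreover L̃_q ∩ [0, m̃_q) = π_q(M^abs_{≤_lex}) ∩ [0, m̃_q) = {0} ∪ {π_q(ρ_2((τ_{0,2}^n(0))^∞)) : n ≥ 0}. -/

import Mathlib

open scoped Classical

noncomputable section

/-- The ultrametric on infinite words: `d(a,b) = 2^{-min{n ≥ 1 : a_n ≠ b_n}}`
(words are indexed from 0 here, so position `i` corresponds to `n = i+1`). -/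
noncomputable def wdist {A : Type*} [DecidableEq A] (a b : ℕ → A) : ℝ :=
  if h : ∃ n, a n ≠ b n then (2 : ℝ)⁻¹ ^ (Nat.find h + 1) else 0

/-- The tail `a_{k+1} a_{k+2} ⋯` of an infinite word. -/
def shiftn {A : Type*} (a : ℕ → A) (k : ℕ) : ℕ → A := fun n => a (n + k)

/-- The set of tails of an infinite word (including the word itself). -/
def tails {A : Type*} (a : ℕ → A) : Set (ℕ → A) := {b | ∃ k, b = shiftn a k}

/-- A cylinder order: a total order such that `a ≤ b ≤ c` implies `d(a,b) ≤ d(a,c)`. -/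
def IsCylOrder {A : Type*} [DecidableEq A] (le : (ℕ → A) → (ℕ → A) → Prop) : Prop :=
  (∀ a b, le a b ∨ le b a) ∧
  (∀ a b, le a b → le b a → a = b) ∧
  (∀ a b c, le a b → le b c → le a c) ∧
  (∀ a b c, le a b → le b c → wdist a b ≤ wdist a c)

/-- Strict comparison associated to an order relation. -/
def wlt {A : Type*} (le : (ℕ → A) → (ℕ → A) → Prop) (a b : ℕ → A) : Prop :=
  le a b ∧ a ≠ b

/-- `m` is the least upper bound of the set `s` with respect to `le`. -/
def IsSupOf {A : Type*} (le : (ℕ → A) → (ℕ → A) → Prop) (s : Set (ℕ → A))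
    (m : ℕ → A) : Prop :=
  (∀ x ∈ s, le x m) ∧ ∀ b, (∀ x ∈ s, le x b) → le m b

/-- The set `M_≤ = {s_≤(a) : a ∈ A^∞}` of sup-words. -/
def supWords {A : Type*} (le : (ℕ → A) → (ℕ → A) → Prop) : Set (ℕ → A) :=
  {m | ∃ a, IsSupOf le (tails a) m}

/-- `x` is an accumulation point of `M` in the metric `wdist`. -/
def IsAccPt' {A : Type*} [DecidableEq A] (M : Set (ℕ → A)) (x : ℕ → A) : Prop :=
  ∀ ε : ℝ, 0 < ε → ∃ y ∈ M, y ≠ x ∧ wdist x y < ε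

/-- `x` is the smallest (w.r.t. `le`) accumulation point of `M`. -/
def IsSmallestAcc {A : Type*} [DecidableEq A] (le : (ℕ → A) → (ℕ → A) → Prop)
    (M : Set (ℕ → A)) (x : ℕ → A) : Prop :=
  IsAccPt' M x ∧ ∀ y, IsAccPt' M y → le x y

/-- Membership in the cylinder given by the finite word `w`. -/
def inCyl {A : Type*} (w : List A) (a : ℕ → A) : Prop :=
  ∀ i : Fin w.length, a i.val = w.get i

/-- `[u] < [v]` for cylinders: every element of `[u]` is strictly below every element of `[v]`. -/
def cylLt {A : Type*} (le : (ℕ → A) → (ℕ → A) → Prop) (u v : List A) : Prop :=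
  ∀ a b, inCyl u a → inCyl v b → wlt le a b

/-- Infinite binary words. -/
abbrev W2 := ℕ → Bool

/-- The word `0^∞`. -/
def w0 : W2 := fun _ => false

/-- The word `1^∞`. -/
def w1 : W2 := fun _ => true

/-- The word `10^∞`. -/
def w10inf : W2 := fun n => decide (n = 0)

/-- The periodic word `w^∞` for a finite word `w`. -/
def perW (w : List Bool) : W2 := fun n => w.getD (n % w.length) false

/-- A substitution on `{0,1}`, given by the images of the two letters. -/
abbrev Sub2 := Bool → List Bool

/-- Action of a substitution on finite words. -/
def listApply (f : Sub2) (l : List Bool) : List Bool := (l.map f).flatten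

/-- Action of a (nonerasing) substitution on infinite words. -/
def subApply (f : Sub2) (a : W2) : W2 :=
  fun n => (listApply f (List.ofFn (fun i : Fin (n + 1) => a i.val))).getD n false

/-- The substitution `τ_{j,k} : 0 ↦ 10^j, 1 ↦ 10^k`. -/
def tauS (j k : ℕ) : Sub2 := fun b => true :: List.replicate (if b then k else j) false

/-- Membership in the set `S = {τ_{j,k} : 0 ≤ j < k}`. -/
def memS (f : Sub2) : Prop := ∃ j k : ℕ, j < k ∧ f = tauS j k

/-- Apply a finite composition `σ_1 ∘ ⋯ ∘ σ_n` (given as a list) to an infinite word. -/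
def applyList (L : List Sub2) (a : W2) : W2 := L.foldr subApply a

/-- Apply a finite composition `σ_1 ∘ ⋯ ∘ σ_n` (given as a list) to a finite word. -/
def listApplyL (L : List Sub2) (l : List Bool) : List Bool := L.foldr listApply l

/-- `σ_{[1,n]} = σ_1 ∘ ⋯ ∘ σ_n` applied to an infinite word, for `σ ∈ S^∞`
(indexed from 0 in Lean). -/
def compUpTo (σ : ℕ → Sub2) (n : ℕ) (a : W2) : W2 :=
  applyList (List.ofFn (fun i : Fin n => σ i.val)) a

/-- `m` is the limit word `lim_{n → ∞} σ_{[1,n]}(a)`. -/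
def IsLimitWord (σ : ℕ → Sub2) (a m : W2) : Prop :=
  ∀ ε : ℝ, 0 < ε → ∃ N : ℕ, ∀ n ≥ N, wdist (compUpTo σ n a) m < ε

/-- Strict alternating lexicographic order on `{0,1}^∞`: at the first differing position
`i` (0-indexed, so the paper's index `n = i+1`), `a <_alt b` iff `a_i < b_i` and `i+1` is
odd (i.e. `i` even), or `a_i > b_i` and `i+1` is even (i.e. `i` odd). -/
def altLt (a b : W2) : Prop :=
  ∃ i : ℕ, (∀ m < i, a m = b m) ∧
    (if Even i then a i = false ∧ b i = true else a i = true ∧ b i = false)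

/-- The alternating lexicographic order on `{0,1}^∞`. -/
def altLe (a b : W2) : Prop := a = b ∨ altLt a b

/-- The symmetric alphabet `{0, ±1}`. -/
inductive T3 where
  | neg : T3
  | zer : T3
  | pos : T3
deriving DecidableEq

/-- The integer value of a letter in `{0, ±1}`. -/
def T3.toInt : T3 → ℤ
  | .neg => -1
  | .zer => 0
  | .pos => 1

/-- Negation of a letter. -/
def T3.negT : T3 → T3
  | .neg => .pos
  | .zer => .zer
  | .pos => .neg

/-- The natural order `-1 < 0 < 1` on letters. -/
def t3lt (x y : T3) : Prop := x.toInt < y.toInt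

/-- Infinite words over `{0, ±1}`. -/
abbrev W3 := ℕ → T3

/-- Letterwise negation of a word. -/
def negW (a : W3) : W3 := fun n => (a n).negT

/-- Strict lexicographic order on `{0,±1}^∞` induced by `-1 < 0 < 1`. -/
def lex3lt (a b : W3) : Prop := ∃ i : ℕ, (∀ m < i, a m = b m) ∧ t3lt (a i) (b i)

/-- Lexicographic order on `{0,±1}^∞` induced by `-1 < 0 < 1`. -/
def lex3le (a b : W3) : Prop := a = b ∨ lex3lt a b

/-- The word `0^∞` over `{0,±1}`. -/
def zeroW3 : W3 := fun _ => T3.zer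

/-- The word `1^∞` over `{0,±1}`. -/
def oneW3 : W3 := fun _ => T3.pos

/-- `abs(a) = a` if `a ≥_lex 0^∞` and `-a` otherwise. -/
noncomputable def absW (a : W3) : W3 := if lex3le zeroW3 a then a else negW a

/-- The set `{abs(a_n a_{n+1} ⋯) : n ≥ 1}`. -/
def absTails (a : W3) : Set W3 := {b | ∃ k, b = absW (shiftn a k)}

/-- The set `M^abs_≤ = {s^abs_≤(a) : a ∈ {0,±1}^∞}`, where `s^abs_≤(a)` is the least upper
bound of `{abs(a_n a_{n+1} ⋯) : n ≥ 1}` with respect to `≤`. -/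
def MAbs (le : W3 → W3 → Prop) : Set W3 := {m | ∃ a, IsSupOf le (absTails a) m}

/-- A cylinder order on `{0,±1}^∞` is consistent if for each finite word `w` either
`[w(-1)] < [w0] < [w1]` or `[w(-1)] > [w0] > [w1]`. -/
def Consistent (le : W3 → W3 → Prop) : Prop :=
  ∀ w : List T3,
    (cylLt le (w ++ [T3.neg]) (w ++ [T3.zer]) ∧ cylLt le (w ++ [T3.zer]) (w ++ [T3.pos])) ∨
    (cylLt le (w ++ [T3.pos]) (w ++ [T3.zer]) ∧ cylLt le (w ++ [T3.zer]) (w ++ [T3.neg]))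

/-- Image of a letter under a `ρ`-map: letter `0 ↦ e` and letter `1 ↦ e0`, where the
sign `e` is `1` if the parity bit is `true` and `-1` otherwise. -/
def rhoImg (e : Bool) (b : Bool) : List T3 :=
  (if e then T3.pos else T3.neg) :: (if b then [T3.zer] else [])

/-- The `ρ`-map on finite words determined by a parity function `par` (where `par w`
is `true` when the relevant count of `w` is even). -/
def rhoL (par : List Bool → Bool) (l : List Bool) : List T3 :=
  (List.ofFn (fun i : Fin l.length => rhoImg (par (l.take i.val)) (l.get i))).flatten

/-- The extension of a `ρ`-map to infinite words (as the limit of its values on prefixes). -/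
def rhoW (par : List Bool → Bool) (a : W2) : W3 :=
  fun n => (rhoL par (List.ofFn (fun i : Fin (n + 1) => a i.val))).getD n T3.zer

/-- Parity for `ρ_0`: evenness of the number of 0's. -/
def par0 : List Bool → Bool := fun w => decide (Even (w.count false))

/-- Parity for `ρ_1`: evenness of the number of 1's. -/
def par1 : List Bool → Bool := fun w => decide (Even (w.count true))

/-- Parity for `ρ_2`: evenness of the length. -/
def par2 : List Bool → Bool := fun w => decide (Even w.length)

/-- The substitution `τ_{0,1} : 0 ↦ 1, 1 ↦ 10` viewed with values in `{0,±1}`. -/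
def tau01T : Bool → List T3 := fun b => if b then [T3.pos, T3.zer] else [T3.pos]

/-- Action on infinite words of a substitution from `{0,1}` to `{0,±1}`-words. -/
def subApply3 (f : Bool → List T3) (a : W2) : W3 :=
  fun n => ((List.ofFn (fun i : Fin (n + 1) => a i.val)).map f).flatten.getD n T3.zer

/-- The set of maps `{ρ_0, ρ_1, ρ_2, τ_{0,1}}` from `{0,1}^∞` to `{0,±1}^∞`. -/
def sigmaSet : Set (W2 → W3) := {rhoW par0, rhoW par1, rhoW par2, subApply3 tau01T}

/-- `π_β(a) = Σ_{n ≥ 1} a_n β^{-n}` for a word over `{0,±1}`. -/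
noncomputable def piBeta3 (β : ℝ) (a : W3) : ℝ :=
  ∑' n : ℕ, ((a n).toInt : ℝ) / β ^ (n + 1)

/-- Distance from a real number to the nearest integer. -/
noncomputable def distNearInt (y : ℝ) : ℝ := |y - round y|

/-- The multiplicative Lagrange spectrum `L̃_q = {limsup_{n→∞} ‖x q^n‖ : x ∈ ℝ}`. -/
noncomputable def Ltilde (q : ℝ) : Set ℝ :=
  {r | ∃ x : ℝ, Filter.limsup (fun n : ℕ => distNearInt (x * q ^ n)) Filter.atTop = r}

/-- The finite word `τ_{0,2}^n(0)`. -/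
def tauIter02 : ℕ → List Bool
  | 0 => [false]
  | n + 1 => listApply (tauS 0 2) (tauIter02 n)

/-- `x` is an accumulation point of a set of reals. -/
def IsAccR (S : Set ℝ) (x : ℝ) : Prop := ∀ ε : ℝ, 0 < ε → ∃ y ∈ S, y ≠ x ∧ |y - x| < ε

/-- `x` is the smallest accumulation point of a set of reals. -/
def IsSmallestAccR (S : Set ℝ) (x : ℝ) : Prop := IsAccR S x ∧ ∀ y, IsAccR S y → x ≤ y

/-! ### Infinite words -/

/-- Prepend a letter to an infinite word. -/
def wcons {A : Type*} (c : A) (x : ℕ → A) : ℕ → A := fun n => Nat.casesOn n c x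

@[simp] lemma wcons_zero {A : Type*} (c : A) (x : ℕ → A) : wcons c x 0 = c := rfl

@[simp] lemma wcons_succ {A : Type*} (c : A) (x : ℕ → A) (n : ℕ) : wcons c x (n + 1) = x n := rfl

@[simp] lemma shiftn_zero {A : Type*} (x : ℕ → A) : shiftn x 0 = x := rfl

lemma shiftn_shiftn {A : Type*} (x : ℕ → A) (j k : ℕ) :
    shiftn (shiftn x j) k = shiftn x (j + k) := by
  funext n
  simp only [shiftn]
  congr 1
  omega

@[simp] lemma shiftn_wcons {A : Type*} (c : A) (x : ℕ → A) (n : ℕ) :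
    shiftn (wcons c x) (n + 1) = shiftn x n := rfl

lemma wcons_head_tail {A : Type*} (x : ℕ → A) : wcons (x 0) (shiftn x 1) = x := by
  funext n
  cases n <;> rfl

lemma exists_eq_wcons {A : Type*} (x : ℕ → A) : ∃ c y, x = wcons c y :=
  ⟨_, _, (wcons_head_tail x).symm⟩

/-- Two words have the same prefix of length `n`. -/
def Agree {A : Type*} (n : ℕ) (x y : ℕ → A) : Prop := ∀ i < n, x i = y i

lemma agree_zero {A : Type*} (x y : ℕ → A) : Agree 0 x y := fun i hi => absurd hi (by omega)

lemma Agree.mono {A : Type*} {n k : ℕ} {x y : ℕ → A} (h : Agree n x y) (hk : k ≤ n) :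
    Agree k x y := fun i hi => h i (by omega)

lemma Agree.symm {A : Type*} {n : ℕ} {x y : ℕ → A} (h : Agree n x y) : Agree n y x :=
  fun i hi => (h i hi).symm

lemma Agree.trans {A : Type*} {n : ℕ} {x y z : ℕ → A} (h : Agree n x y) (h' : Agree n y z) :
    Agree n x z := fun i hi => (h i hi).trans (h' i hi)

lemma Agree.shiftn {A : Type*} {n k : ℕ} {x y : ℕ → A} (h : Agree (k + n) x y) :
    Agree n (shiftn x k) (shiftn y k) := fun i hi => h (i + k) (by omega)

lemma agree_wcons_iff {A : Type*} {n : ℕ} {c d : A} {x y : ℕ → A} :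
    Agree (n + 1) (wcons c x) (wcons d y) ↔ c = d ∧ Agree n x y := by
  refine ⟨fun h => ⟨h 0 (by omega), fun i hi => h (i + 1) (by omega)⟩, ?_⟩
  rintro ⟨rfl, h⟩ (_ | i) hi
  · rfl
  · exact h i (by omega)

lemma eq_of_forall_agree {A : Type*} {x y : ℕ → A} (h : ∀ n, Agree n x y) : x = y :=
  funext fun n => h (n + 1) n (by omega)

/-- Compactness of the space of words over a finite alphabet. -/
lemma exists_frequently_agree {A : Type*} [Finite A] (x : ℕ → ℕ → A) :
    ∃ y : ℕ → A, ∀ k, ∃ᶠ n in Filter.atTop, Agree k (x n) y := by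
  let _ : TopologicalSpace A := ⊥
  have : DiscreteTopology A := ⟨rfl⟩
  obtain ⟨y, u, hu, hy⟩ := CompactSpace.tendsto_subseq x
  refine ⟨y, fun k => ?_⟩
  rw [tendsto_pi_nhds] at hy
  have h : ∀ i, ∀ᶠ n in Filter.atTop, x (u n) i = y i := fun i => by
    have := hy i
    rw [nhds_discrete, Filter.tendsto_pure] at this
    exact this
  have h2 : ∀ᶠ n in Filter.atTop, ∀ i ∈ Finset.range k, x (u n) i = y i := by
    rw [Filter.eventually_all_finset]
    exact fun i _ => h i
  have h3 : ∀ᶠ n in Filter.atTop, Agree k (x (u n)) y :=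
    h2.mono fun n hn i hi => hn i (Finset.mem_range.2 hi)
  exact hu.tendsto_atTop.frequently h3.frequently

lemma agree_of_wdist_lt {A : Type*} [DecidableEq A] {x y : ℕ → A} {n : ℕ}
    (h : wdist x y < (2 : ℝ)⁻¹ ^ n) : Agree n x y := by
  intro i hi
  by_contra hne
  unfold wdist at h
  rw [dif_pos ⟨i, hne⟩] at h
  have h1 := (pow_lt_pow_iff_right_of_lt_one₀ (by norm_num : (0 : ℝ) < 2⁻¹) (by norm_num)).1 h
  have h2 := Nat.find_min' (⟨i, hne⟩ : ∃ n, x n ≠ y n) hne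
  omega

lemma wdist_lt_of_agree {A : Type*} [DecidableEq A] {x y : ℕ → A} {n : ℕ}
    (h : Agree n x y) : wdist x y < (2 : ℝ)⁻¹ ^ n := by
  unfold wdist
  split_ifs with hne
  · refine pow_lt_pow_right_of_lt_one₀ (by norm_num) (by norm_num) ?_
    by_contra hlt
    exact Nat.find_spec hne (h _ (by omega))
  · positivity

/-! ### Flattening sequences of blocks -/

/-- The infinite concatenation of a sequence of blocks. -/
def flat {B : Type*} (d : B) (L : ℕ → List B) : ℕ → B :=
  fun n => (List.ofFn (fun i : Fin (n + 1) => L i)).flatten.getD n d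

/-- Prepend a finite word to an infinite word. -/
def wapp {A : Type*} (l : List A) (x : ℕ → A) : ℕ → A := l.foldr wcons x

@[simp] lemma wapp_cons {A : Type*} (c : A) (l : List A) (x : ℕ → A) :
    wapp (c :: l) x = wcons c (wapp l x) := rfl

lemma wapp_append {A : Type*} (l l' : List A) (x : ℕ → A) :
    wapp (l ++ l') x = wapp l (wapp l' x) := by
  simp [wapp, List.foldr_append]

lemma wapp_of_lt {A : Type*} (d : A) (l : List A) (x : ℕ → A) {n : ℕ} (h : n < l.length) :
    wapp l x n = l.getD n d := by
  induction l generalizing n with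
  | nil => simp at h
  | cons c l ih =>
    cases n with
    | zero => rfl
    | succ n => simpa using ih (by simpa using h)

lemma wapp_add_length {A : Type*} (l : List A) (x : ℕ → A) (n : ℕ) :
    wapp l x (n + l.length) = x n := by
  induction l with
  | nil => rfl
  | cons c l ih => simpa [← add_assoc] using ih

lemma le_length_flatten_ofFn {B : Type*} (L : ℕ → List B) (hL : ∀ i, L i ≠ []) (n : ℕ) :
    n ≤ (List.ofFn (fun i : Fin n => L i)).flatten.length := by
  induction n generalizing L with
  | zero => simp
  | succ n ih =>
    have h0 := List.length_pos_of_ne_nil (hL 0)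
    have := ih (fun i => L (i + 1)) fun i => hL _
    simp only [List.ofFn_succ, List.flatten_cons, List.length_append, Fin.val_zero, Fin.val_succ]
    omega

lemma flatten_ofFn_add {B : Type*} (L : ℕ → List B) (n k : ℕ) :
    (List.ofFn (fun i : Fin (n + k) => L i)).flatten =
      (List.ofFn (fun i : Fin n => L i)).flatten ++
        (List.ofFn (fun i : Fin k => L (n + i))).flatten := by
  rw [← List.flatten_append, List.ofFn_add]
  rfl

lemma flat_eq_getD {B : Type*} (d : B) (L : ℕ → List B) (hL : ∀ i, L i ≠ []) {n k : ℕ}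
    (h : n < k) : flat d L n = (List.ofFn (fun i : Fin k => L i)).flatten.getD n d := by
  obtain ⟨j, rfl⟩ := Nat.exists_eq_add_of_lt h
  have := le_length_flatten_ofFn L hL (n + 1)
  have e := flatten_ofFn_add L (n + 1) j
  rw [show n + j + 1 = n + 1 + j by omega, e, List.getD_append _ _ _ _ (by omega), flat]

lemma flat_eq_wapp {B : Type*} (d : B) (L : ℕ → List B) (hL : ∀ i, L i ≠ []) :
    flat d L = wapp (L 0) (flat d (fun i => L (i + 1))) := by
  funext n
  have h0 := List.length_pos_of_ne_nil (hL 0)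
  have e : flat d L n = (L 0 ++ (List.ofFn (fun i : Fin n => L (i + 1))).flatten).getD n d := by
    simp [flat, List.ofFn_succ]
  rw [e]
  by_cases h : n < (L 0).length
  · rw [List.getD_append _ _ _ _ h, wapp_of_lt d _ _ h]
  · obtain ⟨k, rfl⟩ := Nat.exists_eq_add_of_le' (not_lt.1 h)
    rw [List.getD_append_right _ _ _ _ (by omega), wapp_add_length,
      flat_eq_getD d _ (fun i => hL _) (show k < k + (L 0).length by omega)]
    simp

/-! ### The substitution `τ_{0,2}` and the map `ρ_2` on infinite words -/

@[simp] lemma negT_negT (a : T3) : a.negT.negT = a := by cases a <;> rfl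

@[simp] lemma negW_negW (x : W3) : negW (negW x) = x := funext fun _ => negT_negT _

lemma shiftn_negW (x : W3) (k : ℕ) : shiftn (negW x) k = negW (shiftn x k) := rfl

/-- The substitution `τ_{0,2}` on infinite words. -/
def tauW : W2 → W2 := subApply (tauS 0 2)

lemma tauW_wcons (c : Bool) (x : W2) : tauW (wcons c x) = wapp (tauS 0 2 c) (tauW x) := by
  have h : ∀ b, tauW b = flat false (fun i => tauS 0 2 (b i)) := fun b => by
    funext n
    simp only [tauW, subApply, listApply, flat, List.map_ofFn]
    rfl
  rw [h, flat_eq_wapp _ _ fun i => by simp [tauS], h]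
  simp

@[simp] lemma tauW_false (x : W2) : tauW (wcons false x) = wcons true (tauW x) := by
  rw [tauW_wcons]
  rfl

@[simp] lemma tauW_true (x : W2) :
    tauW (wcons true x) = wcons true (wcons false (wcons false (tauW x))) := by
  rw [tauW_wcons]
  rfl

lemma tauW_head (x : W2) : tauW x 0 = true := by
  obtain ⟨c, y, rfl⟩ := exists_eq_wcons x
  cases c <;> simp

lemma tauW_wapp (l : List Bool) (x : W2) :
    tauW (wapp l x) = wapp (listApply (tauS 0 2) l) (tauW x) := by
  induction l with
  | nil => rfl
  | cons c l ih =>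
    rw [wapp_cons, tauW_wcons, ih, ← wapp_append]
    rfl

/-- The map `ρ_2` on infinite words. -/
def rho : W2 → W3 := rhoW par2

lemma rhoW_par2_eq_flat (b : W2) :
    rhoW par2 b = flat T3.zer (fun i => rhoImg (decide (Even i)) (b i)) := by
  funext n
  simp only [rhoW, rhoL, flat]
  congr 2
  apply List.ext_getElem
  · simp
  · intro i h1 h2
    simp [par2]

lemma flat_map_negT (L : ℕ → List T3) :
    flat T3.zer (fun i => (L i).map T3.negT) = negW (flat T3.zer L) := by
  funext n
  have h : (List.ofFn (fun i : Fin (n + 1) => (L i).map T3.negT)).flatten =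
      ((List.ofFn (fun i : Fin (n + 1) => L i)).flatten).map T3.negT := by
    rw [List.map_flatten, List.map_ofFn]
    rfl
  rw [flat, h, show T3.zer = T3.negT T3.zer from rfl, List.getD_map]
  rfl

lemma rho_wcons (c : Bool) (x : W2) :
    rho (wcons c x) = wapp (rhoImg true c) (negW (rho x)) := by
  have hne : ∀ e b, rhoImg e b ≠ [] := fun e b => by simp [rhoImg]
  rw [rho, rhoW_par2_eq_flat, flat_eq_wapp _ _ fun i => hne _ _, rhoW_par2_eq_flat,
    ← flat_map_negT]
  congr 2
  funext i
  have h : ∀ e b, (rhoImg e b).map T3.negT = rhoImg (!e) b := by decide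
  rw [h]
  simp [Nat.even_add_one, -Nat.not_even_iff_odd]

@[simp] lemma rho_false (x : W2) : rho (wcons false x) = wcons T3.pos (negW (rho x)) := by
  rw [rho_wcons]
  rfl

@[simp] lemma rho_true (x : W2) :
    rho (wcons true x) = wcons T3.pos (wcons T3.zer (negW (rho x))) := by
  rw [rho_wcons]
  rfl

/-! ### The alternating lexicographic order -/

lemma altLt_induction {P : W2 → W2 → Prop}
    (hhead : ∀ x y, P (wcons false x) (wcons true y))
    (htail : ∀ c x y, altLt y x → P y x → P (wcons c x) (wcons c y)) {x y : W2}
    (h : altLt x y) : P x y := by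
  obtain ⟨i, hi, hc⟩ := h
  induction i generalizing x y with
  | zero =>
    rw [← wcons_head_tail x, ← wcons_head_tail y]
    simp only [Even.zero, if_true] at hc
    rw [hc.1, hc.2]
    exact hhead _ _
  | succ i ih =>
    have h0 := hi 0 (by omega)
    have hi' : ∀ m < i, shiftn y 1 m = shiftn x 1 m := fun m hm => (hi (m + 1) (by omega)).symm
    have hc' : if Even i then shiftn y 1 i = false ∧ shiftn x 1 i = true
        else shiftn y 1 i = true ∧ shiftn x 1 i = false := by
      by_cases he : Even i
      · simpa [he, Nat.even_add_one, shiftn, and_comm] using hc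
      · simpa [he, Nat.even_add_one, shiftn, and_comm] using hc
    rw [← wcons_head_tail x, ← wcons_head_tail y, ← h0]
    exact htail _ _ _ ⟨i, hi', hc'⟩ (ih hi' hc')

lemma altLt_false_true (x y : W2) : altLt (wcons false x) (wcons true y) :=
  ⟨0, fun m hm => absurd hm (by omega), by simp⟩

lemma altLt_wcons {c : Bool} {x y : W2} (h : altLt y x) : altLt (wcons c x) (wcons c y) := by
  obtain ⟨i, hi, hc⟩ := h
  refine ⟨i + 1, ?_, ?_⟩
  · rintro (_ | m) hm
    · rfl
    · exact (hi m (by omega)).symm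
  · by_cases he : Even i
    · simpa [he, Nat.even_add_one, and_comm] using hc
    · simpa [he, Nat.even_add_one, and_comm] using hc

lemma altLt_of_head {x y : W2} (hx : x 0 = false) (hy : y 0 = true) : altLt x y := by
  rw [← wcons_head_tail x, ← wcons_head_tail y, hx, hy]
  exact altLt_false_true _ _

lemma altLt_or_altLt {x y : W2} (h : x ≠ y) : altLt x y ∨ altLt y x := by
  have hex : ∃ n, x n ≠ y n := Function.ne_iff.1 h
  have hs := Nat.find_spec hex
  have hm : ∀ m < Nat.find hex, x m = y m := fun m hm => not_not.1 (Nat.find_min hex hm)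
  generalize Nat.find hex = i at hs hm
  by_cases he : Even i <;> cases hx : x i <;> cases hy : y i
  all_goals first
    | exact absurd (hx.trans hy.symm) hs
    | (refine Or.inl ⟨i, hm, ?_⟩; simp [he, hx, hy]; done)
    | (refine Or.inr ⟨i, fun m h => (hm m h).symm, ?_⟩; simp [he, hx, hy])

lemma altLt_tauW {x y : W2} (h : altLt x y) : altLt (tauW x) (tauW y) := by
  refine altLt_induction (P := fun x y => altLt (tauW x) (tauW y)) ?_ ?_ h
  · intro x y
    rw [tauW_false, tauW_true]
    exact altLt_wcons (altLt_of_head rfl (tauW_head x))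
  · rintro (_ | _) x y - ih
    · simpa using altLt_wcons ih
    · simpa using altLt_wcons (altLt_wcons (altLt_wcons ih))

/-- The words all of whose tails are at most the word itself. -/
def AltMax (b : W2) : Prop := ∀ k, ¬ altLt b (shiftn b k)

lemma exists_shiftn_tauW (b : W2) (k : ℕ) : ∃ j, shiftn (tauW b) j = tauW (shiftn b k) := by
  induction k generalizing b with
  | zero => exact ⟨0, rfl⟩
  | succ k ih =>
    obtain ⟨c, y, rfl⟩ := exists_eq_wcons b
    obtain ⟨j, hj⟩ := ih y
    cases c
    · exact ⟨j + 1, by simpa using hj⟩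
    · exact ⟨j + 3, by simpa using hj⟩

lemma shiftn_tauW (b : W2) (n : ℕ) :
    shiftn (tauW b) n 0 = false ∨ ∃ k, shiftn (tauW b) n = tauW (shiftn b k) := by
  induction n using Nat.strong_induction_on generalizing b with
  | _ n ih =>
    obtain ⟨c, y, rfl⟩ := exists_eq_wcons b
    have key : ∀ m < n, shiftn (tauW y) m 0 = false ∨
        ∃ k, shiftn (tauW y) m = tauW (shiftn (wcons c y) k) := fun m hm =>
      (ih m hm y).imp_right fun ⟨k, hk⟩ => ⟨k + 1, by simpa using hk⟩
    match n, c with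
    | 0, _ => exact Or.inr ⟨0, rfl⟩
    | n + 1, false => simpa using key n (by omega)
    | 1, true => exact Or.inl rfl
    | 2, true => exact Or.inl rfl
    | n + 3, true => simpa using key n (by omega)

lemma altLt_irrefl (x : W2) : ¬ altLt x x := by
  rintro ⟨i, -, hc⟩
  by_cases he : Even i <;> simp [he] at hc

lemma altLt_asymm {x y : W2} (h : altLt x y) : ¬ altLt y x := by
  rintro ⟨j, hj, hc'⟩
  obtain ⟨i, hi, hc⟩ := h
  have hij : i = j := by
    rcases lt_trichotomy i j with h | h | h
    · have := hj i h
      split_ifs at hc <;> simp_all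
    · exact h
    · have := hi j h
      split_ifs at hc' <;> simp_all
  subst hij
  split_ifs at hc hc' <;> simp_all

lemma altLt_of_tauW {x y : W2} (h : altLt (tauW x) (tauW y)) : altLt x y := by
  by_cases hxy : x = y
  · exact absurd (hxy ▸ h) (altLt_irrefl _)
  · exact (altLt_or_altLt hxy).resolve_right fun h' => altLt_asymm h (altLt_tauW h')

lemma AltMax.tauW {b : W2} (h : AltMax b) : AltMax (tauW b) := by
  intro n hn
  rcases shiftn_tauW b n with h0 | ⟨k, hk⟩
  · exact altLt_asymm hn (altLt_of_head h0 (tauW_head b))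
  · rw [hk] at hn
    exact h k (altLt_of_tauW hn)

lemma AltMax.of_tauW {b : W2} (h : AltMax (_root_.tauW b)) : AltMax b := by
  intro k hk
  obtain ⟨j, hj⟩ := exists_shiftn_tauW b k
  exact h j (hj ▸ altLt_tauW hk)

/-! ### The fixed point of `τ_{0,2}` and its periodic approximations -/

lemma agree_tauW {n : ℕ} {x y : W2} (h : Agree n x y) : Agree (n + 1) (tauW x) (tauW y) := by
  induction n generalizing x y with
  | zero =>
    intro i hi
    obtain rfl : i = 0 := by omega
    rw [tauW_head, tauW_head]
  | succ n ih =>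
    obtain ⟨c, x, rfl⟩ := exists_eq_wcons x
    obtain ⟨d, y, rfl⟩ := exists_eq_wcons y
    obtain ⟨rfl, hxy⟩ := agree_wcons_iff.1 h
    have := ih hxy
    cases c
    · rw [tauW_false, tauW_false]
      exact agree_wcons_iff.2 ⟨rfl, this⟩
    · rw [tauW_true, tauW_true]
      refine Agree.mono (n := n + 1 + 3) ?_ (by omega)
      exact agree_wcons_iff.2 ⟨rfl, agree_wcons_iff.2 ⟨rfl, agree_wcons_iff.2 ⟨rfl, this⟩⟩⟩

/-- The word `τ_{0,2}^n(0^∞)`. -/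
def tauPow (n : ℕ) : W2 := tauW^[n] w0

lemma tauPow_succ (n : ℕ) : tauPow (n + 1) = tauW (tauPow n) :=
  Function.iterate_succ_apply' _ _ _

lemma agree_tauPow_succ (n : ℕ) : Agree n (tauPow n) (tauPow (n + 1)) := by
  induction n with
  | zero => exact agree_zero _ _
  | succ n ih =>
    rw [tauPow_succ, tauPow_succ (n + 1)]
    exact agree_tauW ih

lemma agree_tauPow_add (n k : ℕ) : Agree n (tauPow n) (tauPow (n + k)) := by
  induction k with
  | zero => exact fun _ _ => rfl
  | succ k ih => exact ih.trans ((agree_tauPow_succ (n + k)).mono (by omega))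

/-- The fixed point of `τ_{0,2}`. -/
def tauFix : W2 := fun n => tauPow (n + 1) n

lemma agree_tauPow_tauFix (n : ℕ) : Agree n (tauPow n) tauFix := by
  intro i hi
  obtain ⟨k, rfl⟩ := Nat.exists_eq_add_of_lt hi
  have := agree_tauPow_add (i + 1) k i (by omega)
  rw [show i + k + 1 = i + 1 + k by omega, ← this]
  rfl

@[simp] lemma tauW_tauFix : tauW tauFix = tauFix := by
  refine eq_of_forall_agree fun n => ?_
  have h := agree_tauW (agree_tauPow_tauFix n)
  rw [← tauPow_succ] at h
  exact (h.symm.trans (agree_tauPow_tauFix (n + 1))).mono (by omega)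

lemma w0_eq : w0 = wcons false w0 := by
  funext n
  cases n <;> rfl

lemma altMax_tauPow (n : ℕ) : AltMax (tauPow n) := by
  induction n with
  | zero => exact fun k => altLt_irrefl w0
  | succ n ih =>
    rw [tauPow_succ]
    exact ih.tauW

lemma tauFix_head : tauFix 0 = true := by
  rw [← tauW_tauFix, tauW_head]

lemma tauPow_altLt_tauFix (n : ℕ) : altLt (tauPow n) tauFix := by
  induction n with
  | zero => exact altLt_of_head rfl tauFix_head
  | succ n ih =>
    rw [tauPow_succ, ← tauW_tauFix]
    exact altLt_tauW ih

lemma tauFix_eq : ∃ y, tauFix =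
    wcons true (wcons false (wcons false (wcons true y))) := by
  obtain ⟨c, x, hx⟩ := exists_eq_wcons tauFix
  have hc : c = true := by
    have := tauFix_head
    rwa [hx] at this
  have h := tauW_tauFix
  rw [hx, hc, tauW_true, ← wcons_head_tail (tauW x), tauW_head] at h
  exact ⟨_, by rw [hx, hc]; exact h.symm⟩

lemma eq_perW {w : List Bool} {y : W2} (hw : w ≠ []) (h : y = wapp w y) : y = perW w := by
  have hpos := List.length_pos_of_ne_nil hw
  funext n
  induction n using Nat.strong_induction_on with
  | _ n ih =>
    by_cases hn : n < w.length
    · rw [h, wapp_of_lt false _ _ hn, perW, Nat.mod_eq_of_lt hn]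
    · obtain ⟨k, rfl⟩ := Nat.exists_eq_add_of_le' (not_lt.1 hn)
      rw [h, wapp_add_length, ih k (by omega), perW, perW, Nat.add_mod_right]

lemma tauPow_eq_perW (n : ℕ) : tauPow n = perW (tauIter02 n) := by
  have h : tauIter02 n ≠ [] ∧ tauPow n = wapp (tauIter02 n) (tauPow n) := by
    induction n with
    | zero => exact ⟨by simp [tauIter02], w0_eq⟩
    | succ n ih =>
      constructor
      · obtain ⟨c, l, hl⟩ := List.exists_cons_of_ne_nil ih.1
        simp [tauIter02, hl, listApply, tauS]
      · rw [tauPow_succ, tauIter02, ← tauW_wapp, ← ih.2]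
  exact eq_perW h.1 h.2

/-! ### Words that are maximal among their tails and below the fixed point -/

/-- A word all of whose tails can be parsed by the operators `G c` lies in the image
of a map satisfying the same recursion. -/
lemma exists_eq_of_parse {A : Type*} {P : (ℕ → A) → Prop} {F : W2 → ℕ → A}
    {G : Bool → (ℕ → A) → ℕ → A}
    (hG : ∀ c n x y, Agree n x y → Agree (n + 1) (G c x) (G c y))
    (hF : ∀ c b, F (wcons c b) = G c (F b))
    (hP : ∀ x, P x → ∃ c y, x = G c y ∧ P y) {x : ℕ → A} (hx : P x) : ∃ b, x = F b := by
  choose c y hxy hy using fun x : {x // P x} => hP x.1 x.2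
  let s : {x // P x} → {x // P x} := fun x => ⟨y x, hy x⟩
  let b : {x // P x} → W2 := fun x n => c (s^[n] x)
  have hb : ∀ x, b x = wcons (c x) (b (s x)) := fun x => by
    funext n
    cases n <;> rfl
  have key : ∀ n x, Agree n x.1 (F (b x)) := by
    intro n
    induction n with
    | zero => exact fun x => agree_zero _ _
    | succ n ih =>
      intro x
      rw [hb, hF, hxy x]
      exact hG _ _ _ _ (ih (s x))
  exact ⟨b ⟨x, hx⟩, eq_of_forall_agree fun n => key n ⟨x, hx⟩⟩

lemma agree_wapp {A : Type*} {n : ℕ} {l : List A} {x y : ℕ → A} (hl : l ≠ [])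
    (h : Agree n x y) : Agree (n + 1) (wapp l x) (wapp l y) := by
  have key : ∀ l : List A, Agree (n + l.length) (wapp l x) (wapp l y) := fun l => by
    induction l with
    | nil => exact h
    | cons c l ih => exact agree_wcons_iff.2 ⟨rfl, ih⟩
  have := List.length_pos_of_ne_nil hl
  exact (key l).mono (by omega)

lemma exists_eq_tauW {b : W2} (h0 : b 0 = true)
    (h : ∀ k, b k = true → b (k + 1) = true ∨
      (b (k + 1) = false ∧ b (k + 2) = false ∧ b (k + 3) = true)) : ∃ b', b = tauW b' := by
  refine exists_eq_of_parse (P := fun b => b 0 = true ∧ ∀ k, b k = true → b (k + 1) = true ∨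
      (b (k + 1) = false ∧ b (k + 2) = false ∧ b (k + 3) = true))
      (G := fun c => wapp (tauS 0 2 c))
      (fun c n x y => agree_wapp (by simp [tauS])) tauW_wcons ?_ ⟨h0, h⟩
  rintro x ⟨hx0, hx⟩
  rcases hx 0 hx0 with h1 | ⟨h1, h2, h3⟩
  · refine ⟨false, shiftn x 1, ?_, h1, fun k => hx (k + 1)⟩
    change x = wcons true (shiftn x 1)
    rw [← hx0, wcons_head_tail]
  · refine ⟨true, shiftn x 3, ?_, h3, fun k => hx (k + 3)⟩
    change x = wcons true (wcons false (wcons false (shiftn x 3)))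
    funext n
    match n with
    | 0 => exact hx0
    | 1 => exact h1
    | 2 => exact h2
    | n + 3 => rfl

lemma eq_w0_of_altMax {b : W2} (hb : AltMax b) (h0 : b 0 = false) : b = w0 := by
  funext k
  by_contra hk
  exact hb k (altLt_of_head h0 (by simpa [shiftn, w0] using hk))

lemma wcons4 {A : Type*} (x : ℕ → A) :
    x = wcons (x 0) (wcons (x 1) (wcons (x 2) (wcons (x 3) (shiftn x 4)))) := by
  funext n
  match n with
  | 0 => rfl
  | 1 => rfl
  | 2 => rfl
  | 3 => rfl
  | n + 4 => rfl

lemma altLt_iff_wcons4 {x y : W2} : altLt x y ↔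
    altLt (wcons (x 0) (wcons (x 1) (wcons (x 2) (wcons (x 3) (shiftn x 4)))))
      (wcons (y 0) (wcons (y 1) (wcons (y 2) (wcons (y 3) (shiftn y 4))))) := by
  rw [← wcons4 x, ← wcons4 y]

lemma exists_eq_tauW_of_altMax {b : W2} (hb : AltMax b) (hlt : altLt b tauFix)
    (h0 : b 0 = true) : ∃ b', b = tauW b' := by
  refine exists_eq_tauW h0 fun k hk => ?_
  have hbk := altLt_iff_wcons4.not.1 (hb k)
  obtain ⟨y, hy⟩ := tauFix_eq
  have hbt := altLt_iff_wcons4.not.1 (altLt_asymm hlt)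
  rw [hy] at hbt
  cases hk1 : b (k + 1) with
  | true => exact Or.inl rfl
  | false =>
    refine Or.inr ⟨rfl, ?_⟩
    change ¬ altLt (wcons true (wcons false (wcons false (wcons true y)))) _ at hbt
    rw [h0] at hbk hbt
    rw [show shiftn b k 0 = true by rw [← hk, shiftn, Nat.zero_add],
      show shiftn b k 1 = false by rw [← hk1, shiftn, add_comm],
      show shiftn b k 2 = b (k + 2) by rw [shiftn, add_comm],
      show shiftn b k 3 = b (k + 3) by rw [shiftn, add_comm]] at hbk
    cases hb1 : b 1 with
    | true =>
      rw [hb1] at hbk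
      exact absurd (altLt_wcons (altLt_false_true _ _)) hbk
    | false =>
      rw [hb1] at hbk hbt
      cases hb2 : b 2 with
      | true =>
        rw [hb2] at hbt
        exact absurd (altLt_wcons (altLt_wcons (altLt_false_true _ _))) hbt
      | false =>
        rw [hb2] at hbk hbt
        cases hb3 : b 3 with
        | false =>
          rw [hb3] at hbt
          exact absurd (altLt_wcons (altLt_wcons (altLt_wcons (altLt_false_true _ _)))) hbt
        | true =>
          rw [hb3] at hbk
          cases hk2 : b (k + 2) with
          | true =>
            rw [hk2] at hbk
            exact absurd (altLt_wcons (altLt_wcons (altLt_false_true _ _))) hbk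
          | false =>
            rw [hk2] at hbk
            cases hk3 : b (k + 3) with
            | false =>
              rw [hk3] at hbk
              exact absurd (altLt_wcons (altLt_wcons (altLt_wcons (altLt_false_true _ _)))) hbk
            | true => exact ⟨rfl, rfl⟩

/-- The only words below the fixed point of `τ_{0,2}` that are maximal among their
tails are its periodic approximations. -/
lemma exists_eq_tauPow {b : W2} (hb : AltMax b) (hlt : altLt b tauFix) : ∃ n, b = tauPow n := by
  have key : ∀ N, ∀ b : W2, AltMax b → altLt b tauFix → ¬ Agree N b tauFix →
      ∃ n, b = tauPow n := by
    intro N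
    induction N with
    | zero => exact fun b _ _ h => absurd (agree_zero _ _) h
    | succ N ih =>
      intro b hb hlt hN
      cases h0 : b 0 with
      | false => exact ⟨0, eq_w0_of_altMax hb h0⟩
      | true =>
        obtain ⟨b', rfl⟩ := exists_eq_tauW_of_altMax hb hlt h0
        have hlt' : altLt b' tauFix := altLt_of_tauW (by rwa [tauW_tauFix])
        have hN' : ¬ Agree N b' tauFix := fun h => hN (by simpa using agree_tauW h)
        obtain ⟨n, rfl⟩ := ih b' hb.of_tauW hlt' hN'
        exact ⟨n + 1, (tauPow_succ n).symm⟩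
  by_contra hne
  refine altLt_irrefl tauFix ?_
  have : b = tauFix := eq_of_forall_agree fun N => by
    by_contra hN
    exact hne (key N b hb hlt hN)
  rwa [this] at hlt

/-! ### Evaluation of words -/

lemma le_of_forall_half_pow {a b : ℝ} (C : ℝ) (h : ∀ n : ℕ, a ≤ b + C * (1 / 2) ^ n) : a ≤ b := by
  have ht : Filter.Tendsto (fun n : ℕ => b + C * (1 / 2 : ℝ) ^ n) Filter.atTop
      (nhds (b + C * 0)) :=
    ((tendsto_pow_atTop_nhds_zero_of_lt_one (by norm_num) (by norm_num)).const_mul C).const_add b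
  have := ge_of_tendsto' ht h
  simpa using this

lemma abs_toInt_le (c : T3) : |(c.toInt : ℝ)| ≤ 1 := by cases c <;> simp [T3.toInt]

lemma toInt_negT (c : T3) : c.negT.toInt = -c.toInt := by cases c <;> rfl

section Evaluation

variable {β : ℝ}

lemma norm_piBeta3_term_le (hβ : 2 ≤ β) (x : W3) (n : ℕ) :
    ‖((x n).toInt : ℝ) / β ^ (n + 1)‖ ≤ β⁻¹ * β⁻¹ ^ n := by
  have hp : 0 < β ^ (n + 1) := by positivity
  rw [Real.norm_eq_abs, abs_div, abs_of_pos hp, ← pow_succ', inv_pow, div_eq_mul_inv]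
  exact mul_le_of_le_one_left (by positivity) (abs_toInt_le _)

lemma hasSum_geometric_inv (hβ : 2 ≤ β) :
    HasSum (fun n : ℕ => β⁻¹ * β⁻¹ ^ n) (β - 1)⁻¹ := by
  have h := (hasSum_geometric_of_lt_one (r := β⁻¹) (by positivity)
    (inv_lt_one_of_one_lt₀ (by linarith))).mul_left β⁻¹
  have : β ≠ 0 := by positivity
  rwa [← mul_inv, mul_sub, mul_inv_cancel₀ this, mul_one] at h

lemma summable_piBeta3 (hβ : 2 ≤ β) (x : W3) :
    Summable fun n : ℕ => ((x n).toInt : ℝ) / β ^ (n + 1) :=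
  Summable.of_norm_bounded (hasSum_geometric_inv hβ).summable (norm_piBeta3_term_le hβ x)

lemma abs_piBeta3_le (hβ : 2 ≤ β) (x : W3) : |piBeta3 β x| ≤ (β - 1)⁻¹ :=
  tsum_of_norm_bounded (hasSum_geometric_inv hβ) (norm_piBeta3_term_le hβ x)

lemma abs_piBeta3_le_one (hβ : 2 ≤ β) (x : W3) : |piBeta3 β x| ≤ 1 :=
  (abs_piBeta3_le hβ x).trans (inv_le_one_of_one_le₀ (by linarith))

lemma piBeta3_wcons (hβ : 2 ≤ β) (c : T3) (x : W3) :
    piBeta3 β (wcons c x) = β⁻¹ * (c.toInt + piBeta3 β x) := by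
  unfold piBeta3
  rw [(summable_piBeta3 hβ (wcons c x)).tsum_eq_zero_add, mul_add, ← tsum_mul_left]
  congr 1
  · simp [div_eq_inv_mul]
  · congr 1
    funext n
    rw [wcons_succ, pow_succ β (n + 1), div_mul_eq_div_div, div_eq_inv_mul]

lemma piBeta3_eq (hβ : 2 ≤ β) (x : W3) :
    piBeta3 β x = β⁻¹ * ((x 0).toInt + piBeta3 β (shiftn x 1)) := by
  rw [← piBeta3_wcons hβ, wcons_head_tail]

@[simp] lemma piBeta3_negW (x : W3) : piBeta3 β (negW x) = -piBeta3 β x := by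
  unfold piBeta3
  rw [← tsum_neg]
  congr 1
  funext n
  rw [negW, toInt_negT]
  push_cast
  ring

@[simp] lemma piBeta3_zeroW3 : piBeta3 β zeroW3 = 0 := by simp [piBeta3, zeroW3, T3.toInt]

lemma inv_le_half (hβ : 2 ≤ β) : β⁻¹ ≤ 1 / 2 := by
  rw [one_div]
  exact inv_anti₀ (by norm_num) hβ

lemma abs_piBeta3_sub_le (hβ : 2 ≤ β) {n : ℕ} {x y : W3} (h : Agree n x y) :
    |piBeta3 β x - piBeta3 β y| ≤ 2 * (1 / 2) ^ n := by
  induction n generalizing x y with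
  | zero =>
    have hx := abs_le.1 (abs_piBeta3_le_one hβ x)
    have hy := abs_le.1 (abs_piBeta3_le_one hβ y)
    rw [abs_le]
    constructor <;> linarith
  | succ n ih =>
    have h1 : Agree n (shiftn x 1) (shiftn y 1) := Agree.shiftn (h.mono (by omega))
    have hpos : 0 < β⁻¹ := by positivity
    rw [piBeta3_eq hβ x, piBeta3_eq hβ y, h 0 (by omega), ← mul_sub, abs_mul, abs_of_pos hpos,
      add_sub_add_left_eq_sub, pow_succ]
    have := mul_le_mul (inv_le_half hβ) (ih h1) (abs_nonneg _) (by norm_num)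
    linarith

lemma piBeta3_lt_of_lex3lt (hβ : 2 ≤ β) {x y : W3} (h : lex3lt x y)
    (hx : ∀ k, |piBeta3 β (shiftn x k)| < 1 / 2) (hy : ∀ k, |piBeta3 β (shiftn y k)| < 1 / 2) :
    piBeta3 β x < piBeta3 β y := by
  obtain ⟨i, hi, hc⟩ := h
  have hpos : 0 < β⁻¹ := by positivity
  induction i generalizing x y with
  | zero =>
    rw [piBeta3_eq hβ x, piBeta3_eq hβ y]
    have h1 : (((x 0).toInt + 1 : ℤ) : ℝ) ≤ (y 0).toInt := by
      exact_mod_cast (show (x 0).toInt + 1 ≤ (y 0).toInt from hc)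
    push_cast at h1
    have hx1 := abs_lt.1 (hx 1)
    have hy1 := abs_lt.1 (hy 1)
    exact mul_lt_mul_of_pos_left (by linarith) hpos
  | succ i ih =>
    rw [piBeta3_eq hβ x, piBeta3_eq hβ y, hi 0 (by omega)]
    refine mul_lt_mul_of_pos_left (add_lt_add_right (ih ?_ ?_ ?_ ?_) _) hpos
    · intro k
      rw [shiftn_shiftn]
      exact hx _
    · intro k
      rw [shiftn_shiftn]
      exact hy _
    · exact fun m hm => hi (m + 1) (by omega)
    · exact hc

/-! ### Values of the words `ρ_2(b)` -/

lemma piBeta3_rho_false (hβ : 2 ≤ β) (x : W2) :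
    piBeta3 β (rho (wcons false x)) = β⁻¹ * (1 - piBeta3 β (rho x)) := by
  rw [rho_false, piBeta3_wcons hβ, piBeta3_negW]
  simp [T3.toInt, sub_eq_add_neg]

lemma piBeta3_rho_true (hβ : 2 ≤ β) (x : W2) :
    piBeta3 β (rho (wcons true x)) = β⁻¹ * (1 - β⁻¹ * piBeta3 β (rho x)) := by
  rw [rho_true, piBeta3_wcons hβ, piBeta3_wcons hβ, piBeta3_negW]
  simp [T3.toInt, sub_eq_add_neg]

lemma piBeta3_rho_mem_Icc (hβ : 2 ≤ β) (b : W2) : piBeta3 β (rho b) ∈ Set.Icc 0 β⁻¹ := by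
  have ht := inv_le_half hβ
  have hpos : 0 < β⁻¹ := by positivity
  have key : ∀ n : ℕ, ∀ b, -(1 / 2) ^ n ≤ piBeta3 β (rho b) ∧
      piBeta3 β (rho b) ≤ β⁻¹ + (1 / 2) ^ n := by
    intro n
    induction n with
    | zero =>
      intro b
      have := abs_le.1 (abs_piBeta3_le_one hβ (rho b))
      constructor <;> linarith
    | succ n ih =>
      intro b
      obtain ⟨c, y, rfl⟩ := exists_eq_wcons b
      obtain ⟨h1, h2⟩ := ih y
      have hd : (0 : ℝ) < (1 / 2) ^ n := by positivity
      rw [pow_succ]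
      generalize ((1 : ℝ) / 2) ^ n = d at *
      cases c
      · rw [piBeta3_rho_false hβ]
        constructor <;> nlinarith
      · rw [piBeta3_rho_true hβ]
        have h3 : -d * β⁻¹ ≤ β⁻¹ * piBeta3 β (rho y) := by nlinarith
        have h4 : β⁻¹ * piBeta3 β (rho y) ≤ β⁻¹ * (1 / 2 + d) := by nlinarith
        have h5 : β⁻¹ * (-d * β⁻¹) ≤ β⁻¹ * (β⁻¹ * piBeta3 β (rho y)) :=
          mul_le_mul_of_nonneg_left h3 hpos.le
        have h6 : d * (β⁻¹ * β⁻¹) ≤ d * (1 / 2) :=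
          mul_le_mul_of_nonneg_left (by nlinarith) hd.le
        constructor <;> nlinarith
  constructor
  · refine le_of_forall_half_pow 1 fun n => ?_
    have := (key n b).1
    linarith
  · refine le_of_forall_half_pow 1 fun n => ?_
    have := (key n b).2
    linarith

lemma le_piBeta3_rho (hβ : 2 ≤ β) (b : W2) : β⁻¹ - β⁻¹ ^ 2 ≤ piBeta3 β (rho b) := by
  have ht := inv_le_half hβ
  have hpos : 0 < β⁻¹ := by positivity
  obtain ⟨c, y, rfl⟩ := exists_eq_wcons b
  obtain ⟨h1, h2⟩ := piBeta3_rho_mem_Icc hβ y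
  cases c
  · rw [piBeta3_rho_false hβ]
    nlinarith
  · rw [piBeta3_rho_true hβ]
    have : β⁻¹ * piBeta3 β (rho y) ≤ β⁻¹ := by nlinarith
    nlinarith

lemma piBeta3_rho_pos (hβ : 2 ≤ β) (b : W2) : 0 < piBeta3 β (rho b) := by
  have ht := inv_le_half hβ
  have hpos : 0 < β⁻¹ := by positivity
  have := le_piBeta3_rho hβ b
  nlinarith

lemma piBeta3_rho_lt (hβ : 2 ≤ β) (b : W2) : piBeta3 β (rho b) < β⁻¹ := by
  have hpos : 0 < β⁻¹ := by positivity
  obtain ⟨c, y, rfl⟩ := exists_eq_wcons b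
  have := piBeta3_rho_pos hβ y
  cases c
  · rw [piBeta3_rho_false hβ]
    nlinarith
  · rw [piBeta3_rho_true hβ]
    have : 0 < β⁻¹ * piBeta3 β (rho y) := by positivity
    nlinarith

lemma piBeta3_rho_lt_half (hβ : 2 ≤ β) (b : W2) : piBeta3 β (rho b) < 1 / 2 :=
  (piBeta3_rho_lt hβ b).trans_le (inv_le_half hβ)

lemma piBeta3_rho_strictMono (hβ : 2 ≤ β) {x y : W2} (h : altLt x y) :
    piBeta3 β (rho x) < piBeta3 β (rho y) := by
  have ht := inv_le_half hβ
  have hpos : 0 < β⁻¹ := by positivity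
  refine altLt_induction (P := fun x y => piBeta3 β (rho x) < piBeta3 β (rho y)) ?_ ?_ h
  · intro x y
    rw [piBeta3_rho_false hβ, piBeta3_rho_true hβ]
    have h1 := le_piBeta3_rho hβ x
    have h2 := piBeta3_rho_lt hβ y
    refine mul_lt_mul_of_pos_left ?_ hpos
    have : β⁻¹ * piBeta3 β (rho y) < β⁻¹ * β⁻¹ := mul_lt_mul_of_pos_left h2 hpos
    nlinarith
  · rintro (_ | _) x y - ih
    · rw [piBeta3_rho_false hβ, piBeta3_rho_false hβ]
      exact mul_lt_mul_of_pos_left (by linarith) hpos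
    · rw [piBeta3_rho_true hβ, piBeta3_rho_true hβ]
      have := mul_lt_mul_of_pos_left ih hpos
      exact mul_lt_mul_of_pos_left (by linarith) hpos

lemma altLt_of_piBeta3_rho_lt (hβ : 2 ≤ β) {x y : W2}
    (h : piBeta3 β (rho x) < piBeta3 β (rho y)) : altLt x y := by
  by_cases hxy : x = y
  · exact absurd (hxy ▸ h) (lt_irrefl _)
  · exact (altLt_or_altLt hxy).resolve_right fun h' =>
      lt_asymm h (piBeta3_rho_strictMono hβ h')

lemma altMax_iff (hβ : 2 ≤ β) {b : W2} :
    AltMax b ↔ ∀ k, piBeta3 β (rho (shiftn b k)) ≤ piBeta3 β (rho b) :=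
  forall_congr' fun _ =>
    ⟨fun h => not_lt.1 fun h' => h (altLt_of_piBeta3_rho_lt hβ h'),
      fun h h' => (piBeta3_rho_strictMono hβ h').not_ge h⟩

lemma agree_rho {n : ℕ} {x y : W2} (h : Agree n x y) : Agree n (rho x) (rho y) := by
  induction n generalizing x y with
  | zero => exact agree_zero _ _
  | succ n ih =>
    obtain ⟨c, x, rfl⟩ := exists_eq_wcons x
    obtain ⟨d, y, rfl⟩ := exists_eq_wcons y
    obtain ⟨rfl, hxy⟩ := agree_wcons_iff.1 h
    rw [rho_wcons, rho_wcons]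
    exact agree_wapp (by simp [rhoImg]) fun i hi => congrArg T3.negT (ih hxy i hi)

lemma exists_shiftn_rho (b : W2) (k : ℕ) : ∃ j ≥ k,
    shiftn (rho b) j = rho (shiftn b k) ∨ shiftn (rho b) j = negW (rho (shiftn b k)) := by
  induction k generalizing b with
  | zero => exact ⟨0, le_rfl, Or.inl rfl⟩
  | succ k ih =>
    obtain ⟨c, y, rfl⟩ := exists_eq_wcons b
    obtain ⟨j, hjk, hj⟩ := ih y
    cases c
    · refine ⟨j + 1, by omega, ?_⟩
      rw [rho_false, shiftn_wcons, shiftn_wcons, shiftn_negW]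
      rcases hj with hj | hj <;> simp [hj]
    · refine ⟨j + 2, by omega, ?_⟩
      rw [rho_true, shiftn_wcons, shiftn_wcons, shiftn_wcons, shiftn_negW]
      rcases hj with hj | hj <;> simp [hj]

lemma exists_abs_shiftn_rho_le (hβ : 2 ≤ β) (b : W2) (n : ℕ) :
    ∃ k, |piBeta3 β (shiftn (rho b) n)| ≤ piBeta3 β (rho (shiftn b k)) := by
  induction n using Nat.strong_induction_on generalizing b with
  | _ n ih =>
    obtain ⟨c, y, rfl⟩ := exists_eq_wcons b
    have key : ∀ m < n, ∃ k, |piBeta3 β (shiftn (negW (rho y)) m)| ≤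
        piBeta3 β (rho (shiftn (wcons c y) k)) := fun m hm => by
      obtain ⟨k, hk⟩ := ih m hm y
      exact ⟨k + 1, by simpa [shiftn_negW] using hk⟩
    match n, c with
    | 0, _ => exact ⟨0, by rw [shiftn_zero, shiftn_zero, abs_of_pos (piBeta3_rho_pos hβ _)]⟩
    | n + 1, false => simpa using key n (by omega)
    | 1, true =>
      refine ⟨1, ?_⟩
      rw [rho_true, shiftn_wcons, shiftn_zero, shiftn_wcons, shiftn_zero, piBeta3_wcons hβ,
        piBeta3_negW]
      have h1 := piBeta3_rho_pos hβ y
      have h2 := inv_le_half hβ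
      have hpos : 0 < β⁻¹ := by positivity
      simp only [T3.toInt, Int.cast_zero, zero_add, abs_mul, abs_neg, abs_of_pos h1,
        abs_of_pos hpos]
      nlinarith
    | n + 2, true => simpa using key n (by omega)

lemma AltMax.abs_shiftn_rho_le (hβ : 2 ≤ β) {b : W2} (hb : AltMax b) (n : ℕ) :
    |piBeta3 β (shiftn (rho b) n)| ≤ piBeta3 β (rho b) := by
  obtain ⟨k, hk⟩ := exists_abs_shiftn_rho_le hβ b n
  exact hk.trans ((altMax_iff hβ).1 hb k)

end Evaluation

/-! ### Suprema of sets of words -/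

lemma lex3lt_or_lex3lt {x y : W3} (h : x ≠ y) : lex3lt x y ∨ lex3lt y x := by
  have hex : ∃ n, x n ≠ y n := Function.ne_iff.1 h
  have hs := Nat.find_spec hex
  have hm : ∀ m < Nat.find hex, x m = y m := fun m hm => not_not.1 (Nat.find_min hex hm)
  have hinj : ∀ c d : T3, c.toInt = d.toInt → c = d := by
    intro c d
    cases c <;> cases d <;> simp [T3.toInt]
  rcases lt_trichotomy (x (Nat.find hex)).toInt (y (Nat.find hex)).toInt with h | h | h
  · exact Or.inl ⟨_, hm, h⟩
  · exact absurd (hinj _ _ h) hs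
  · exact Or.inr ⟨_, fun m hmm => (hm m hmm).symm, h⟩

lemma lex3lt_iff {x y : W3} : lex3lt x y ↔ piBeta3 5 x < piBeta3 5 y := by
  have h5 : ∀ z : W3, |piBeta3 5 z| < 1 / 2 := fun z =>
    (abs_piBeta3_le (by norm_num) z).trans_lt (by norm_num)
  have key : ∀ {x y : W3}, lex3lt x y → piBeta3 5 x < piBeta3 5 y := fun h =>
    piBeta3_lt_of_lex3lt (by norm_num) h (fun _ => h5 _) fun _ => h5 _
  refine ⟨key, fun h => ?_⟩
  by_cases hxy : x = y
  · exact absurd (hxy ▸ h) (lt_irrefl _)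
  · exact (lex3lt_or_lex3lt hxy).resolve_right fun h' => lt_asymm h (key h')

lemma piBeta3_five_injective : Function.Injective (piBeta3 5) := by
  intro x y h
  by_contra hxy
  rcases lex3lt_or_lex3lt hxy with h' | h'
  · exact (lex3lt_iff.1 h').ne h
  · exact (lex3lt_iff.1 h').ne' h

lemma lex3le_iff {x y : W3} : lex3le x y ↔ piBeta3 5 x ≤ piBeta3 5 y := by
  rw [lex3le, lex3lt_iff, le_iff_eq_or_lt, piBeta3_five_injective.eq_iff]

lemma piBeta3_rho_injective {β : ℝ} (hβ : 2 ≤ β) :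
    Function.Injective fun b => piBeta3 β (rho b) := by
  intro x y h
  by_contra hxy
  rcases altLt_or_altLt hxy with h' | h'
  · exact (piBeta3_rho_strictMono hβ h').ne h
  · exact (piBeta3_rho_strictMono hβ h').ne' h

lemma altLe_iff {β : ℝ} (hβ : 2 ≤ β) {x y : W2} :
    altLe x y ↔ piBeta3 β (rho x) ≤ piBeta3 β (rho y) := by
  rw [altLe, le_iff_eq_or_lt, (piBeta3_rho_injective hβ).eq_iff]
  exact or_congr_right ⟨piBeta3_rho_strictMono hβ, altLt_of_piBeta3_rho_lt hβ⟩

/-- A real-valued map on infinite words that is Lipschitz for the ultrametric. -/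
def LipWord {A : Type*} (φ : (ℕ → A) → ℝ) : Prop :=
  ∀ n x y, Agree n x y → |φ x - φ y| ≤ 2 * (1 / 2) ^ n

lemma lipWord_piBeta3 {β : ℝ} (hβ : 2 ≤ β) : LipWord (piBeta3 β) :=
  fun _ _ _ h => abs_piBeta3_sub_le hβ h

lemma lipWord_piBeta3_rho {β : ℝ} (hβ : 2 ≤ β) : LipWord fun b => piBeta3 β (rho b) :=
  fun _ _ _ h => abs_piBeta3_sub_le hβ (agree_rho h)

/-- For an order induced by an injective Lipschitz map, a supremum lies in the closure. -/
lemma IsSupOf.exists_agree {A : Type*} [Finite A] {le : (ℕ → A) → (ℕ → A) → Prop}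
    {φ : (ℕ → A) → ℝ} (hφ : LipWord φ) (hinj : Function.Injective φ)
    (hle : ∀ x y, le x y ↔ φ x ≤ φ y) {S : Set (ℕ → A)} (hS : S.Nonempty) {m : ℕ → A}
    (hm : IsSupOf le S m) (n : ℕ) : ∃ x ∈ S, Agree n x m := by
  have hub : ∀ x ∈ S, φ x ≤ φ m := fun x hx => (hle _ _).1 (hm.1 x hx)
  have hbdd : BddAbove (φ '' S) := ⟨φ m, by rintro _ ⟨x, hx, rfl⟩; exact hub x hx⟩
  have hex : ∀ j : ℕ, ∃ x ∈ S, sSup (φ '' S) - (1 / 2) ^ j < φ x := fun j => by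
    obtain ⟨_, ⟨x, hx, rfl⟩, h⟩ := exists_lt_of_lt_csSup (hS.image φ)
      (sub_lt_self (sSup (φ '' S)) (show (0 : ℝ) < (1 / 2) ^ j by positivity))
    exact ⟨x, hx, h⟩
  choose x hxS hx using hex
  obtain ⟨y, hy⟩ := exists_frequently_agree x
  have h1 : sSup (φ '' S) ≤ φ y := le_of_forall_half_pow 3 fun k => by
    obtain ⟨j, hj, hjk⟩ := ((hy k).and_eventually (Filter.eventually_ge_atTop k)).exists
    have h2 := (abs_le.1 (hφ k _ _ hj)).2
    have h3 : ((1 : ℝ) / 2) ^ j ≤ (1 / 2) ^ k :=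
      pow_le_pow_of_le_one (by norm_num) (by norm_num) hjk
    linarith [hx j]
  have h2 : φ y ≤ φ m := le_of_forall_half_pow 2 fun k => by
    obtain ⟨j, hj⟩ := (hy k).exists
    linarith [(abs_le.1 (hφ k _ _ hj)).1, hub _ (hxS j)]
  have h3 : φ m ≤ φ y := (hle _ _).1 <| hm.2 y fun z hz =>
    (hle _ _).2 ((le_csSup hbdd ⟨z, hz, rfl⟩).trans h1)
  obtain rfl : y = m := hinj (le_antisymm h2 h3)
  obtain ⟨j, hj⟩ := (hy n).exists
  exact ⟨_, hxS j, hj⟩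

lemma mem_supWords_altLe_iff {m : W2} : m ∈ supWords altLe ↔ AltMax m := by
  have h2 : (2 : ℝ) ≤ 5 := by norm_num
  constructor
  · rintro ⟨a, ha⟩
    rw [altMax_iff h2]
    intro k
    refine le_of_forall_half_pow 2 fun n => ?_
    obtain ⟨_, ⟨j, rfl⟩, hj⟩ := ha.exists_agree (lipWord_piBeta3_rho h2)
      (piBeta3_rho_injective h2) (fun _ _ => altLe_iff h2) (S := tails a) ⟨a, 0, rfl⟩ (k + n)
    have h3 := abs_le.1 (lipWord_piBeta3_rho h2 n _ _ (Agree.shiftn hj))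
    have h4 := (altLe_iff h2).1 (ha.1 _ ⟨j + k, rfl⟩)
    rw [shiftn_shiftn] at h3
    linarith [h3.1]
  · intro h
    refine ⟨m, ?_, fun b hb => hb m ⟨0, rfl⟩⟩
    rintro _ ⟨k, rfl⟩
    exact (altLe_iff h2).2 ((altMax_iff h2).1 h k)

/-- The words that bound all their tails and the opposites of their tails. -/
def AbsMax (m : W3) : Prop := ∀ k, |piBeta3 5 (shiftn m k)| ≤ piBeta3 5 m

lemma absW_eq (x : W3) : absW x = x ∨ absW x = negW x := by
  unfold absW
  split_ifs
  · exact Or.inl rfl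
  · exact Or.inr rfl

lemma piBeta3_five_absW (x : W3) : piBeta3 5 (absW x) = |piBeta3 5 x| := by
  unfold absW
  split_ifs with h
  · rw [lex3le_iff, piBeta3_zeroW3] at h
    rw [abs_of_nonneg h]
  · rw [lex3le_iff, piBeta3_zeroW3, not_le] at h
    rw [abs_of_neg h, piBeta3_negW]

instance : Finite T3 := Finite.of_injective (fun c => Fin.ofNat 3 (c.toInt + 1).toNat)
  (by intro c d; cases c <;> cases d <;> simp [T3.toInt, Fin.ext_iff])

lemma mem_MAbs_iff {m : W3} : m ∈ MAbs lex3le ↔ AbsMax m := by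
  have h2 : (2 : ℝ) ≤ 5 := by norm_num
  constructor
  · rintro ⟨a, ha⟩ k
    refine le_of_forall_half_pow 2 fun n => ?_
    obtain ⟨_, ⟨j, rfl⟩, hj⟩ := ha.exists_agree (lipWord_piBeta3 h2)
      piBeta3_five_injective (fun _ _ => lex3le_iff) (S := absTails a) ⟨_, 0, rfl⟩ (k + n)
    have h3 := lipWord_piBeta3 h2 n _ _ (Agree.shiftn hj)
    have h4 := lex3le_iff.1 (ha.1 _ ⟨j + k, rfl⟩)
    have h5 : |piBeta3 5 (shiftn (absW (shiftn a j)) k)| =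
        piBeta3 5 (absW (shiftn a (j + k))) := by
      rw [piBeta3_five_absW, ← shiftn_shiftn]
      rcases absW_eq (shiftn a j) with h | h
      · rw [h]
      · rw [h, shiftn_negW, piBeta3_negW, abs_neg]
    have h6 := abs_sub_abs_le_abs_sub (piBeta3 5 (shiftn m k))
      (piBeta3 5 (shiftn (absW (shiftn a j)) k))
    rw [abs_sub_comm] at h3
    linarith
  · intro h
    refine ⟨m, ?_, fun b hb => ?_⟩
    · rintro _ ⟨k, rfl⟩
      rw [lex3le_iff, piBeta3_five_absW]
      exact h k
    · have := lex3le_iff.1 (hb _ ⟨0, rfl⟩)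
      rw [piBeta3_five_absW] at this
      exact lex3le_iff.2 ((le_abs_self _).trans this)

/-! ### Classification of the maximal words below `ρ_2` of the fixed point -/

lemma exists_eq_rho {m : W3} (h0 : m 0 = T3.pos)
    (h : ∀ k, m k ≠ T3.zer → m (k + 1) = (m k).negT ∨
      (m (k + 1) = T3.zer ∧ m (k + 2) = (m k).negT)) : ∃ b, m = rho b := by
  refine exists_eq_of_parse (P := fun m => m 0 = T3.pos ∧ ∀ k, m k ≠ T3.zer →
      m (k + 1) = (m k).negT ∨ (m (k + 1) = T3.zer ∧ m (k + 2) = (m k).negT))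
      (G := fun c x => wapp (rhoImg true c) (negW x))
      (fun c n x y hxy => agree_wapp (by simp [rhoImg])
        fun i hi => congrArg T3.negT (hxy i hi)) rho_wcons ?_ ⟨h0, h⟩
  rintro x ⟨hx0, hx⟩
  have hneg : ∀ c : T3, c.negT = T3.zer ↔ c = T3.zer := by
    intro c
    cases c <;> simp [T3.negT]
  have hinj : ∀ c d : T3, c.negT = d.negT ↔ c = d := by
    intro c d
    cases c <;> cases d <;> simp [T3.negT]
  have hP : ∀ j, ∀ k, negW (shiftn x j) k ≠ T3.zer →
      negW (shiftn x j) (k + 1) = (negW (shiftn x j) k).negT ∨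
        (negW (shiftn x j) (k + 1) = T3.zer ∧
          negW (shiftn x j) (k + 2) = (negW (shiftn x j) k).negT) := by
    intro j k hk
    simp only [negW, shiftn, hneg, hinj, Ne] at hk ⊢
    have := hx (k + j) hk
    rwa [add_right_comm k j 1, add_right_comm k j 2] at this
  have h1 := hx 0 (by simp [hx0])
  rw [hx0] at h1
  rcases h1 with h1 | ⟨h1, h2⟩
  · refine ⟨false, negW (shiftn x 1), ?_, ?_, hP 1⟩
    · change x = wcons T3.pos (negW (negW (shiftn x 1)))
      rw [negW_negW, ← hx0, wcons_head_tail]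
    · change (x 1).negT = T3.pos
      rw [h1]
      rfl
  · refine ⟨true, negW (shiftn x 2), ?_, ?_, hP 2⟩
    · change x = wcons T3.pos (wcons T3.zer (negW (negW (shiftn x 2))))
      rw [negW_negW]
      funext n
      match n with
      | 0 => exact hx0
      | 1 => exact h1
      | n + 2 => rfl
    · change (x 2).negT = T3.pos
      rw [h2]
      rfl

lemma toInt_le_of_not_lex3lt {x y : W3} (h : ¬ lex3lt x y) {n : ℕ} (hn : Agree n x y) :
    (y n).toInt ≤ (x n).toInt := not_lt.1 fun hc => h ⟨n, hn, hc⟩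

lemma AbsMax.exists_normalized {m : W3} (h : AbsMax m) {k : ℕ} (hk : m k ≠ T3.zer) :
    ∃ z, (z = shiftn m k ∨ z = negW (shiftn m k)) ∧ z 0 = T3.pos ∧ ¬ lex3lt m z := by
  have h1 := abs_le.1 (h k)
  cases hc : m k with
  | zer => exact absurd hc hk
  | pos =>
    refine ⟨_, Or.inl rfl, by simpa [shiftn] using hc, ?_⟩
    rw [lex3lt_iff, not_lt]
    exact h1.2
  | neg =>
    refine ⟨_, Or.inr rfl, by simp [shiftn, negW, hc, T3.negT], ?_⟩
    rw [lex3lt_iff, not_lt, piBeta3_negW]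
    linarith [h1.1]

lemma AbsMax.exists_eq_rho {m : W3} (h : AbsMax m) (h0 : m 0 = T3.pos)
    (h12 : m 1 = T3.neg ∨ m 1 = T3.zer ∧ m 2 = T3.neg) : ∃ b, m = rho b := by
  refine _root_.exists_eq_rho h0 fun k hk => ?_
  obtain ⟨z, hz, hz0, hmz⟩ := h.exists_normalized hk
  have a1 : Agree 1 m z := by
    intro i hi
    obtain rfl : i = 0 := by omega
    rw [h0, hz0]
  have l1 := toInt_le_of_not_lex3lt hmz a1
  have key : z 1 = T3.neg ∨ z 1 = T3.zer ∧ z 2 = T3.neg := by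
    rcases h12 with h1 | ⟨h1, h2⟩
    · left
      rw [h1] at l1
      cases hc : z 1 <;> simp_all [T3.toInt]
    · rw [h1] at l1
      cases hc : z 1 with
      | neg => exact Or.inl rfl
      | pos => simp [hc, T3.toInt] at l1
      | zer =>
        have a2 : Agree 2 m z := by
          intro i hi
          obtain rfl | rfl : i = 0 ∨ i = 1 := by omega
          · rw [h0, hz0]
          · rw [h1, hc]
        have l2 := toInt_le_of_not_lex3lt hmz a2
        rw [h2] at l2
        refine Or.inr ⟨rfl, ?_⟩
        cases hc2 : z 2 <;> simp_all [T3.toInt]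
  rcases hz with rfl | rfl
  · simp only [shiftn, Nat.zero_add] at hz0 key
    rw [hz0, add_comm k 1, add_comm k 2]
    exact key
  · have e1 : ∀ c : T3, c.negT = T3.pos ↔ c = T3.neg := by intro c; cases c <;> simp [T3.negT]
    have e2 : ∀ c : T3, c.negT = T3.neg ↔ c = T3.pos := by intro c; cases c <;> simp [T3.negT]
    have e3 : ∀ c : T3, c.negT = T3.zer ↔ c = T3.zer := by intro c; cases c <;> simp [T3.negT]
    simp only [shiftn, negW, Nat.zero_add, e1, e2, e3] at hz0 key
    rw [hz0, add_comm k 1, add_comm k 2]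
    exact key

section Classification

variable {β : ℝ}

lemma piBeta3_eq_three (hβ : 2 ≤ β) (x : W3) : piBeta3 β x = β⁻¹ * ((x 0).toInt +
    β⁻¹ * ((x 1).toInt + β⁻¹ * ((x 2).toInt + piBeta3 β (shiftn x 3)))) := by
  rw [piBeta3_eq hβ x, piBeta3_eq hβ (shiftn x 1), piBeta3_eq hβ (shiftn (shiftn x 1) 1),
    shiftn_shiftn, shiftn_shiftn]
  rfl

lemma piBeta3_rho_tauFix_le (hβ : 2 ≤ β) :
    piBeta3 β (rho tauFix) ≤ β⁻¹ - β⁻¹ ^ 3 + β⁻¹ ^ 4 - β⁻¹ ^ 5 + β⁻¹ ^ 7 := by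
  obtain ⟨y, hy⟩ := tauFix_eq
  rw [hy, piBeta3_rho_true hβ, piBeta3_rho_false hβ, piBeta3_rho_false hβ, piBeta3_rho_true hβ]
  have hpos : 0 < β⁻¹ := by positivity
  have h := mul_le_mul_of_nonneg_left (piBeta3_rho_mem_Icc hβ y).2
    (show 0 ≤ β⁻¹ ^ 6 by positivity)
  linarith

lemma abs_piBeta3_le_two_mul (hβ : 2 ≤ β) (x : W3) : |piBeta3 β x| ≤ 2 * β⁻¹ := by
  refine (abs_piBeta3_le hβ x).trans ?_
  rw [inv_le_iff_one_le_mul₀ (by linarith), mul_assoc, inv_mul_eq_div, mul_div_assoc']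
  rw [le_div_iff₀ (by linarith)]
  linarith

lemma AbsMax.abs_piBeta3_shiftn_le (hβ : 2 ≤ β) {m : W3} (h : AbsMax m) (h0 : m 0 = T3.pos)
    (h1 : m 1 = T3.zer) (h2 : m 2 = T3.zer) (k : ℕ) :
    |piBeta3 β (shiftn m k)| ≤ β⁻¹ + 2 * β⁻¹ ^ 4 := by
  have ht := inv_le_half hβ
  have hpos : 0 < β⁻¹ := by positivity
  by_cases hk : m k = T3.zer
  · have hk' : shiftn m k 0 = T3.zer := by rwa [shiftn, Nat.zero_add]
    rw [piBeta3_eq hβ, hk', abs_mul, abs_of_pos hpos]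
    have := mul_le_mul_of_nonneg_left (abs_piBeta3_le_one hβ (shiftn (shiftn m k) 1)) hpos.le
    simp only [T3.toInt, Int.cast_zero, zero_add]
    have : 0 < β⁻¹ ^ 4 := by positivity
    linarith
  · obtain ⟨z, hz, hz0, hmz⟩ := h.exists_normalized hk
    have e : |piBeta3 β (shiftn m k)| = |piBeta3 β z| := by
      rcases hz with rfl | rfl <;> simp
    have a1 : Agree 1 m z := by
      intro i hi
      obtain rfl : i = 0 := by omega
      rw [h0, hz0]
    have l1 := toInt_le_of_not_lex3lt hmz a1
    have b2 := abs_le.1 (abs_piBeta3_le_one hβ (shiftn z 2))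
    have hp2 : 0 < β⁻¹ ^ 2 := by positivity
    have hp4 : 0 < β⁻¹ ^ 4 := by positivity
    have e2 : piBeta3 β z = β⁻¹ + β⁻¹ ^ 2 * ((z 1).toInt + piBeta3 β (shiftn z 2)) := by
      rw [piBeta3_eq hβ z, piBeta3_eq hβ (shiftn z 1), shiftn_shiftn, hz0]
      simp only [T3.toInt, shiftn]
      push_cast
      ring
    rw [h1] at l1
    rw [e, abs_le]
    cases hc : z 1 with
    | pos => simp [hc, T3.toInt] at l1
    | neg =>
      rw [hc] at e2
      simp only [T3.toInt] at e2
      push_cast at e2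
      rw [e2]
      constructor <;> nlinarith
    | zer =>
      have a2 : Agree 2 m z := by
        intro i hi
        obtain rfl | rfl : i = 0 ∨ i = 1 := by omega
        · rw [h0, hz0]
        · rw [h1, hc]
      have l2 := toInt_le_of_not_lex3lt hmz a2
      rw [h2] at l2
      have l3 : ((z 2).toInt : ℝ) ≤ 0 := by exact_mod_cast l2
      have e3 := piBeta3_eq_three hβ z
      have b3 := (abs_le.1 (abs_piBeta3_le_two_mul hβ (shiftn z 3))).2
      rw [hc] at e2
      simp only [T3.toInt] at e2
      push_cast at e2
      constructor
      · rw [e2]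
        nlinarith
      · rw [hz0, hc, show T3.pos.toInt = 1 from rfl, show T3.zer.toInt = 0 from rfl] at e3
        push_cast at e3
        have hp3 : 0 < β⁻¹ ^ 3 := by positivity
        have := mul_le_mul_of_nonneg_left (add_le_add l3 b3) hp3.le
        rw [e3]
        linarith

/-- The maximal words whose value is below that of `ρ_2` of the fixed point. -/
lemma AbsMax.eq_or_exists_eq (hβ : 2 ≤ β) {m : W3} (h : AbsMax m)
    (hlt : piBeta3 β m < piBeta3 β (rho tauFix)) :
    m = zeroW3 ∨ ∃ n, m = rho (tauPow n) := by
  have ht := inv_le_half hβ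
  have hpos : 0 < β⁻¹ := by positivity
  have hlt1 := hlt.trans (piBeta3_rho_lt hβ _)
  have e3 := piBeta3_eq_three hβ m
  have b3 := abs_le.1 (abs_piBeta3_le_one hβ (shiftn m 3))
  cases h0 : m 0 with
  | neg =>
    obtain ⟨z, -, hz0, hmz⟩ := h.exists_normalized (k := 0) (by simp [h0])
    have := toInt_le_of_not_lex3lt hmz (agree_zero _ _)
    simp [h0, hz0, T3.toInt] at this
  | zer =>
    left
    funext k
    by_contra hk
    obtain ⟨z, -, hz0, hmz⟩ := h.exists_normalized hk
    have := toInt_le_of_not_lex3lt hmz (agree_zero _ _)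
    simp [h0, hz0, T3.toInt] at this
  | pos =>
    right
    have key : m 1 = T3.neg ∨ m 1 = T3.zer ∧ m 2 = T3.neg := by
      rw [h0] at e3
      cases h1 : m 1 with
      | neg => exact Or.inl rfl
      | pos =>
        exfalso
        have e2 : piBeta3 β m = β⁻¹ + β⁻¹ ^ 2 * (1 + piBeta3 β (shiftn m 2)) := by
          rw [piBeta3_eq hβ m, piBeta3_eq hβ (shiftn m 1), shiftn_shiftn, h0,
            show shiftn m 1 0 = T3.pos from h1]
          simp only [T3.toInt]
          push_cast
          ring
        have b2 := abs_le.1 (abs_piBeta3_le_one hβ (shiftn m 2))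
        have : 0 < β⁻¹ ^ 2 := by positivity
        nlinarith
      | zer =>
        refine Or.inr ⟨rfl, ?_⟩
        rw [h1] at e3
        cases h2 : m 2 with
        | neg => rfl
        | pos =>
          exfalso
          rw [h2] at e3
          simp only [T3.toInt] at e3
          push_cast at e3
          have : 0 < β⁻¹ ^ 3 := by positivity
          nlinarith
        | zer =>
          exfalso
          rw [h2] at e3
          simp only [T3.toInt] at e3
          push_cast at e3
          have hb := (abs_le.1 (h.abs_piBeta3_shiftn_le hβ h0 h1 h2 3)).1
          have hle := hlt.trans_le (piBeta3_rho_tauFix_le hβ)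
          have h3 := mul_le_mul_of_nonneg_left hb (show 0 ≤ β⁻¹ ^ 3 by positivity)
          have h4 : 0 ≤ β⁻¹ ^ 3 * (1 - 2 * β⁻¹) := by
            have : 0 ≤ 1 - 2 * β⁻¹ := by linarith
            positivity
          have h5 : 0 ≤ β⁻¹ ^ 5 * (1 - 3 * β⁻¹ ^ 2) := by
            have : 0 ≤ 1 - 3 * β⁻¹ ^ 2 := by nlinarith
            positivity
          linarith
    obtain ⟨b, rfl⟩ := h.exists_eq_rho h0 key
    have h5 : (2 : ℝ) ≤ 5 := by norm_num
    have hmax : AltMax b := by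
      rw [altMax_iff h5]
      intro k
      obtain ⟨j, -, hj⟩ := exists_shiftn_rho b k
      have := h j
      rcases hj with hj | hj
      · rw [hj] at this
        exact (le_abs_self _).trans this
      · rw [hj, piBeta3_negW, abs_neg] at this
        exact (le_abs_self _).trans this
    obtain ⟨n, rfl⟩ := exists_eq_tauPow hmax (altLt_of_piBeta3_rho_lt hβ hlt)
    exact ⟨n, rfl⟩

end Classification

/-! ### Smallest accumulation points -/

lemma le_of_isAccR {S : Set ℝ} {p : ℕ → ℝ} {m z : ℝ}
    (hp : Filter.Tendsto p Filter.atTop (nhds m))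
    (hS : ∀ s ∈ S, s < m → s = z ∨ ∃ n, s = p n) {y : ℝ} (hy : IsAccR S y) : m ≤ y := by
  by_contra! hlt
  obtain ⟨N, hN⟩ := Filter.eventually_atTop.1
    (hp.eventually (lt_mem_nhds (show (y + m) / 2 < m by linarith)))
  let F : Set ℝ := (insert z (p '' Set.Iio N)) \ {y}
  have hF : F.Finite := ((Set.finite_Iio N).image p |>.insert z).subset Set.sdiff_subset
  have hyF : y ∈ Fᶜ := fun h => h.2 rfl
  obtain ⟨δ, hδ, hball⟩ := Metric.isOpen_iff.1 hF.isClosed.isOpen_compl y hyF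
  obtain ⟨s, hsS, hsy, hs⟩ := hy (min δ ((m - y) / 2)) (lt_min hδ (by linarith))
  have hs2 := (abs_lt.1 (hs.trans_le (min_le_right _ _))).2
  refine hball (show s ∈ Metric.ball y δ from hs.trans_le (min_le_left _ _)) ⟨?_, hsy⟩
  rcases hS s hsS (by linarith) with rfl | ⟨n, rfl⟩
  · exact Set.mem_insert _ _
  · refine Set.mem_insert_of_mem _ ⟨n, Set.mem_Iio.2 (not_le.1 fun hn => ?_), rfl⟩
    linarith [hN n hn]

lemma isSmallestAccR_of_tendsto {S : Set ℝ} {p : ℕ → ℝ} {m z : ℝ}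
    (hp : Filter.Tendsto p Filter.atTop (nhds m)) (hpS : ∀ n, p n ∈ S) (hpm : ∀ n, p n ≠ m)
    (hS : ∀ s ∈ S, s < m → s = z ∨ ∃ n, s = p n) : IsSmallestAccR S m := by
  refine ⟨fun ε hε => ?_, fun y hy => le_of_isAccR hp hS hy⟩
  obtain ⟨n, hn⟩ := (hp.eventually (Metric.ball_mem_nhds m hε)).exists
  exact ⟨p n, hpS n, hpm n, hn⟩

lemma LipWord.tendsto {A : Type*} {φ : (ℕ → A) → ℝ} (hφ : LipWord φ) {p : ℕ → ℕ → A}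
    {t : ℕ → A} (hp : ∀ n, Agree n (p n) t) :
    Filter.Tendsto (fun n => φ (p n)) Filter.atTop (nhds (φ t)) := by
  have h0 : Filter.Tendsto (fun n : ℕ => 2 * (1 / 2 : ℝ) ^ n) Filter.atTop (nhds 0) := by
    simpa using (tendsto_pow_atTop_nhds_zero_of_lt_one (r := (1 / 2 : ℝ))
      (by norm_num) (by norm_num)).const_mul 2
  rw [tendsto_iff_dist_tendsto_zero]
  exact squeeze_zero (fun _ => dist_nonneg) (fun n => hφ n _ _ (hp n)) h0

lemma IsSmallestAcc.eq_of_agree {A : Type*} [DecidableEq A]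
    {le : (ℕ → A) → (ℕ → A) → Prop} {φ : (ℕ → A) → ℝ} (hφ : LipWord φ)
    (hinj : Function.Injective φ) (hle : ∀ x y, le x y ↔ φ x ≤ φ y) {M : Set (ℕ → A)}
    {p : ℕ → ℕ → A} {t z x : ℕ → A} (hpM : ∀ n, p n ∈ M) (hpt : ∀ n, Agree n (p n) t)
    (hne : ∀ n, p n ≠ t) (hM : ∀ m ∈ M, φ m < φ t → m = z ∨ ∃ n, m = p n)
    (hx : IsSmallestAcc le M x) : x = t := by
  have hhalf : ∀ ε : ℝ, 0 < ε → ∃ n : ℕ, (2 : ℝ)⁻¹ ^ n < ε := fun ε hε =>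
    exists_pow_lt_of_lt_one hε (by norm_num)
  refine hinj (le_antisymm ((hle _ _).1 (hx.2 t fun ε hε => ?_)) ?_)
  · obtain ⟨n, hn⟩ := hhalf ε hε
    exact ⟨p n, hpM n, hne n, (wdist_lt_of_agree (hpt n).symm).trans hn⟩
  · refine le_of_isAccR (S := φ '' M) (z := φ z) (hφ.tendsto hpt) ?_ fun ε hε => ?_
    · rintro _ ⟨m, hm, rfl⟩ hlt
      exact (hM m hm hlt).imp (congrArg φ) fun ⟨n, hn⟩ => ⟨n, congrArg φ hn⟩
    · obtain ⟨n, hn⟩ := hhalf (ε / 2) (by linarith)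
      obtain ⟨y, hyM, hyx, hy⟩ := hx.1 (2⁻¹ ^ n) (by positivity)
      refine ⟨φ y, ⟨y, hyM, rfl⟩, hinj.ne hyx, ?_⟩
      have := hφ n _ _ (agree_of_wdist_lt hy).symm
      rw [one_div] at this
      linarith

lemma tauPow_ne_tauFix (n : ℕ) : tauPow n ≠ tauFix := fun h =>
  altLt_irrefl _ (h ▸ tauPow_altLt_tauFix n)

lemma eq_tauFix_of_isSmallestAcc {x : W2} (hx : IsSmallestAcc altLe (supWords altLe) x) :
    x = tauFix := by
  have h5 : (2 : ℝ) ≤ 5 := by norm_num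
  exact hx.eq_of_agree (lipWord_piBeta3_rho h5) (piBeta3_rho_injective h5)
    (fun _ _ => altLe_iff h5) (z := tauFix)
    (fun n => mem_supWords_altLe_iff.2 (altMax_tauPow n)) agree_tauPow_tauFix tauPow_ne_tauFix
    fun m hm hlt => Or.inr <|
      exists_eq_tauPow (mem_supWords_altLe_iff.1 hm) (altLt_of_piBeta3_rho_lt h5 hlt)

lemma absMax_rho_tauPow (n : ℕ) : AbsMax (rho (tauPow n)) :=
  (altMax_tauPow n).abs_shiftn_rho_le (by norm_num)

lemma eq_rho_tauFix_of_isSmallestAcc {x : W3} (hx : IsSmallestAcc lex3le (MAbs lex3le) x) :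
    x = rho tauFix := by
  have h5 : (2 : ℝ) ≤ 5 := by norm_num
  refine hx.eq_of_agree (lipWord_piBeta3 h5) piBeta3_five_injective (fun _ _ => lex3le_iff)
    (z := zeroW3) (fun n => mem_MAbs_iff.2 (absMax_rho_tauPow n))
    (fun n => agree_rho (agree_tauPow_tauFix n)) (fun n h => ?_)
    fun m hm hlt => (mem_MAbs_iff.1 hm).eq_or_exists_eq h5 hlt
  exact tauPow_ne_tauFix n (piBeta3_rho_injective h5 (congrArg (piBeta3 5) h))

/-! ### The spectrum -/

lemma distNearInt_nonneg (y : ℝ) : 0 ≤ distNearInt y := abs_nonneg _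

lemma distNearInt_le_half (y : ℝ) : distNearInt y ≤ 1 / 2 := abs_sub_round y

lemma isBoundedUnder_le_distNearInt (f : ℕ → ℝ) :
    Filter.atTop.IsBoundedUnder (· ≤ ·) fun n => distNearInt (f n) :=
  Filter.isBoundedUnder_of ⟨1 / 2, fun _ => distNearInt_le_half _⟩

lemma isCoboundedUnder_le_distNearInt (f : ℕ → ℝ) :
    Filter.atTop.IsCoboundedUnder (· ≤ ·) fun n => distNearInt (f n) :=
  Filter.IsBoundedUnder.isCoboundedUnder_le
    (Filter.isBoundedUnder_of ⟨0, fun _ => distNearInt_nonneg _⟩)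

/-- A limit of tails realizes the limit superior of the absolute values. -/
lemma exists_piBeta3_eq_of_limsup {β r : ℝ} (hβ : 2 ≤ β) {w : W3}
    (hle : ∀ k : ℕ, ∀ᶠ n in Filter.atTop, |piBeta3 β (shiftn w n)| < r + (1 / 2) ^ k)
    (hge : ∀ k : ℕ, ∃ᶠ n in Filter.atTop, r - (1 / 2) ^ k < |piBeta3 β (shiftn w n)|) :
    ∃ y, piBeta3 β y = r ∧ ∀ k, |piBeta3 β (shiftn y k)| ≤ r := by
  have hex : ∀ j : ℕ, ∃ u ≥ j, r - (1 / 2) ^ j < |piBeta3 β (shiftn w u)| := fun j =>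
    ((hge j).and_eventually (Filter.eventually_ge_atTop j)).exists.imp fun _ h => ⟨h.2, h.1⟩
  choose u huj hu using hex
  have hsign : ∀ j, ∃ x, piBeta3 β x = |piBeta3 β (shiftn w (u j))| ∧
      ∀ k, |piBeta3 β (shiftn x k)| = |piBeta3 β (shiftn w (u j + k))| := by
    intro j
    rcases abs_choice (piBeta3 β (shiftn w (u j))) with h | h
    · exact ⟨_, h.symm, fun k => by rw [shiftn_shiftn]⟩
    · exact ⟨negW (shiftn w (u j)), by rw [piBeta3_negW, h],
        fun k => by rw [shiftn_negW, piBeta3_negW, abs_neg, shiftn_shiftn]⟩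
  choose x hx hxk using hsign
  obtain ⟨y, hy⟩ := exists_frequently_agree x
  have hup : ∀ k, |piBeta3 β (shiftn y k)| ≤ r := fun k => le_of_forall_half_pow 3 fun n => by
    obtain ⟨N, hN⟩ := Filter.eventually_atTop.1 (hle n)
    obtain ⟨j, hj, hjN⟩ :=
      ((hy (k + n)).and_eventually (Filter.eventually_ge_atTop N)).exists
    have h1 := hN (u j + k) ((hjN.trans (huj j)).trans (Nat.le_add_right _ _))
    have h2 := abs_piBeta3_sub_le hβ (Agree.shiftn hj)
    rw [abs_sub_comm] at h2
    have h3 := abs_sub_abs_le_abs_sub (piBeta3 β (shiftn y k)) (piBeta3 β (shiftn (x j) k))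
    rw [hxk] at h3
    linarith
  refine ⟨y, le_antisymm ((le_abs_self _).trans (hup 0)) ?_, hup⟩
  refine le_of_forall_half_pow 3 fun n => ?_
  obtain ⟨j, hj, hjn⟩ := ((hy n).and_eventually (Filter.eventually_ge_atTop n)).exists
  have h1 := (abs_le.1 (abs_piBeta3_sub_le hβ hj)).2
  have h2 : ((1 : ℝ) / 2) ^ j ≤ (1 / 2) ^ n :=
    pow_le_pow_of_le_one (by norm_num) (by norm_num) hjn
  linarith [hu j, hx j]

lemma absMax_of_abs_le {β : ℝ} (hβ : 2 ≤ β) {y : W3} (hy : piBeta3 β y < 1 / 2)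
    (h : ∀ k, |piBeta3 β (shiftn y k)| ≤ piBeta3 β y) : AbsMax y := by
  have key : ∀ z, (∀ k, |piBeta3 β (shiftn z k)| ≤ piBeta3 β y) →
      piBeta3 5 z ≤ piBeta3 5 y := by
    intro z hz
    by_contra! hlt
    have h1 := piBeta3_lt_of_lex3lt hβ (lex3lt_iff.2 hlt) (fun k => (h k).trans_lt hy)
      fun k => (hz k).trans_lt hy
    exact h1.not_ge ((le_abs_self _).trans (hz 0))
  intro k
  rw [abs_le']
  refine ⟨key _ fun j => ?_, ?_⟩
  · rw [shiftn_shiftn]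
    exact h _
  · rw [← piBeta3_negW]
    refine key _ fun j => ?_
    rw [shiftn_negW, piBeta3_negW, abs_neg, shiftn_shiftn]
    exact h _

/-- The letter of `{0, ±1}` with the sign of a given integer. -/
def T3.ofInt (s : ℤ) : T3 := if 0 < s then .pos else if s < 0 then .neg else .zer

lemma T3.toInt_ofInt {s : ℤ} (h : |s| < 2) : (T3.ofInt s).toInt = s := by
  rw [abs_lt] at h
  unfold T3.ofInt
  split_ifs <;> simp only [T3.toInt] <;> omega

/-- The signed `q`-adic expansion of a number whose multiples stay close to the integers. -/
lemma exists_shiftn_eq_sub_round {q : ℕ} (hq : 2 ≤ q) {x : ℝ} {N : ℕ}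
    (hN : ∀ n ≥ N, distNearInt (x * q ^ n) < (q : ℝ)⁻¹) :
    ∃ w : W3, ∀ n ≥ N, x * q ^ n - round (x * q ^ n) = piBeta3 q (shiftn w n) := by
  have hβ : (2 : ℝ) ≤ q := by exact_mod_cast hq
  have hpos : (0 : ℝ) < q := by linarith
  set e : ℕ → ℝ := fun n => x * q ^ n - round (x * q ^ n) with he
  let s : ℕ → ℤ := fun n => round (x * q ^ (n + 1)) - q * round (x * q ^ n)
  have hs : ∀ n, q * e n = s n + e (n + 1) := by
    intro n
    simp only [he, s]
    push_cast
    ring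
  have hs2 : ∀ n ≥ N, |s n| < 2 := by
    intro n hn
    have h1 : |e n| < (q : ℝ)⁻¹ := hN n hn
    have h2 : |e (n + 1)| ≤ 1 / 2 := abs_sub_round _
    have h3 : q * |e n| < 1 := by
      have := mul_lt_mul_of_pos_left h1 hpos
      rwa [mul_inv_cancel₀ hpos.ne'] at this
    have h4 : |(s n : ℝ)| < 2 := by
      rw [eq_sub_of_add_eq (hs n).symm]
      refine (abs_sub _ _).trans_lt ?_
      rw [abs_mul, abs_of_pos hpos]
      linarith
    exact_mod_cast h4
  let w : W3 := fun n => T3.ofInt (s n)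
  have hstep : ∀ n ≥ N, e n - piBeta3 q (shiftn w n) =
      (q : ℝ)⁻¹ * (e (n + 1) - piBeta3 q (shiftn w (n + 1))) := by
    intro n hn
    have h1 : (shiftn w n 0).toInt = s n := by
      rw [shiftn, Nat.zero_add]
      exact T3.toInt_ofInt (hs2 n hn)
    rw [piBeta3_eq hβ, h1, shiftn_shiftn, eq_inv_mul_iff_mul_eq₀ hpos.ne', mul_sub, hs,
      mul_inv_cancel_left₀ hpos.ne']
    ring
  have hbound : ∀ k : ℕ, ∀ n ≥ N, |e n - piBeta3 q (shiftn w n)| ≤ 2 * (1 / 2) ^ k := by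
    intro k
    induction k with
    | zero =>
      intro n _
      have h1 : |e n| ≤ 1 / 2 := abs_sub_round _
      have h2 := abs_piBeta3_le_one hβ (shiftn w n)
      have h3 := abs_sub (e n) (piBeta3 q (shiftn w n))
      linarith
    | succ k ih =>
      intro n hn
      rw [hstep n hn, abs_mul, abs_of_pos (by positivity), pow_succ']
      have := mul_le_mul (inv_le_half hβ) (ih (n + 1) (by omega)) (abs_nonneg _) (by norm_num)
      linarith
  refine ⟨w, fun n hn => sub_eq_zero.1 (abs_eq_zero.1 (le_antisymm ?_ (abs_nonneg _)))⟩
  refine le_of_forall_half_pow 2 fun k => ?_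
  rw [zero_add]
  exact hbound k n hn

lemma exists_absMax_of_mem_Ltilde {q : ℕ} (hq : 2 ≤ q) {r : ℝ} (hr : r ∈ Ltilde q)
    (hlt : r < (q : ℝ)⁻¹) : ∃ y, AbsMax y ∧ piBeta3 q y = r := by
  have hβ : (2 : ℝ) ≤ q := by exact_mod_cast hq
  obtain ⟨x, rfl⟩ := hr
  have hbdd := isBoundedUnder_le_distNearInt fun n => x * (q : ℝ) ^ n
  have hcobdd := isCoboundedUnder_le_distNearInt fun n => x * (q : ℝ) ^ n
  obtain ⟨N, hN⟩ := Filter.eventually_atTop.1 (Filter.eventually_lt_of_limsup_lt hlt hbdd)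
  obtain ⟨w, hw⟩ := exists_shiftn_eq_sub_round hq hN
  have heq : ∀ᶠ n : ℕ in Filter.atTop,
      distNearInt (x * (q : ℝ) ^ n) = |piBeta3 q (shiftn w n)| :=
    Filter.eventually_atTop.2 ⟨N, fun n hn => congrArg abs (hw n hn)⟩
  have hhalf : ∀ k : ℕ, (0 : ℝ) < (1 / 2) ^ k := fun k => by positivity
  obtain ⟨y, hy, hyk⟩ := exists_piBeta3_eq_of_limsup hβ (w := w)
    (fun k => ((Filter.eventually_lt_of_limsup_lt (lt_add_of_pos_right _ (hhalf k)) hbdd).and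
      heq).mono fun n h => h.2 ▸ h.1)
    (fun k => ((Filter.frequently_lt_of_lt_limsup hcobdd
      (sub_lt_self _ (hhalf k))).and_eventually heq).mono fun n h => h.2 ▸ h.1)
  refine ⟨y, absMax_of_abs_le hβ ?_ (hy ▸ hyk), hy⟩
  rw [hy]
  exact hlt.trans_le (inv_le_half hβ)

lemma exists_piBeta3_mul_pow_eq {q : ℕ} (hq : 2 ≤ q) (w : W3) (n : ℕ) :
    ∃ k : ℤ, piBeta3 q w * q ^ n = k + piBeta3 q (shiftn w n) := by
  have hβ : (2 : ℝ) ≤ q := by exact_mod_cast hq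
  have hne : (q : ℝ) ≠ 0 := by linarith
  induction n with
  | zero => exact ⟨0, by simp [shiftn_zero]⟩
  | succ n ih =>
    obtain ⟨k, hk⟩ := ih
    refine ⟨k * q + (shiftn w n 0).toInt, ?_⟩
    rw [pow_succ, ← mul_assoc, hk, piBeta3_eq hβ (shiftn w n), shiftn_shiftn]
    push_cast
    field_simp
    ring

lemma distNearInt_eq_abs (k : ℤ) {y : ℝ} (hy : |y| < 1 / 2) : distNearInt (k + y) = |y| := by
  have : round y = 0 := round_eq_zero_iff.2 ⟨by linarith [(abs_lt.1 hy).1], (abs_lt.1 hy).2⟩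
  simp [distNearInt, round_intCast_add, this]

lemma shiftn_perW_mul (l : List Bool) (k : ℕ) : shiftn (perW l) (l.length * k) = perW l := by
  funext n
  simp [shiftn, perW]

lemma piBeta3_rho_perW_mem_Ltilde {q : ℕ} (hq : 2 ≤ q) {l : List Bool} (hl : 0 < l.length)
    (h : AltMax (perW l)) : piBeta3 q (rho (perW l)) ∈ Ltilde q := by
  have hβ : (2 : ℝ) ≤ q := by exact_mod_cast hq
  have hle := h.abs_shiftn_rho_le hβ
  have heq : ∀ n : ℕ, distNearInt (piBeta3 q (rho (perW l)) * (q : ℝ) ^ n) =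
      |piBeta3 q (shiftn (rho (perW l)) n)| := by
    intro n
    obtain ⟨k, hk⟩ := exists_piBeta3_mul_pow_eq hq (rho (perW l)) n
    rw [hk, distNearInt_eq_abs _ ((hle n).trans_lt (piBeta3_rho_lt_half hβ _))]
  refine ⟨piBeta3 q (rho (perW l)), le_antisymm ?_ ?_⟩
  · exact Filter.limsup_le_of_le (isCoboundedUnder_le_distNearInt _)
      (Filter.Eventually.of_forall fun n => (heq n).trans_le (hle n))
  · refine Filter.le_limsup_of_frequently_le (Filter.frequently_atTop.2 fun a => ?_)
      (isBoundedUnder_le_distNearInt _)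
    obtain ⟨j, hja, hj⟩ := exists_shiftn_rho (perW l) (l.length * a)
    refine ⟨j, (Nat.le_mul_of_pos_left a hl).trans hja, ?_⟩
    rw [shiftn_perW_mul] at hj
    rw [heq]
    rcases hj with hj | hj
    · rw [hj]
      exact le_abs_self _
    · rw [hj, piBeta3_negW, abs_neg]
      exact le_abs_self _

lemma zero_mem_Ltilde (q : ℝ) : 0 ∈ Ltilde q := ⟨0, by simp [distNearInt]⟩

lemma length_tauIter02_pos (n : ℕ) : 0 < (tauIter02 n).length := by
  induction n with
  | zero => simp [tauIter02]
  | succ n ih =>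
    obtain ⟨c, l, hl⟩ := List.exists_cons_of_length_pos ih
    simp [tauIter02, listApply, hl, tauS]

lemma piBeta3_rho_tauPow_mem_Ltilde {q : ℕ} (hq : 2 ≤ q) (n : ℕ) :
    piBeta3 q (rho (tauPow n)) ∈ Ltilde q := by
  have h := altMax_tauPow n
  rw [tauPow_eq_perW] at h ⊢
  exact piBeta3_rho_perW_mem_Ltilde hq (length_tauIter02_pos n) h

/-- For every integer `q ≥ 2`, the smallest accumulation point `m̃_q` of
`L̃_q` satisfies `m̃_q = π_q(m^abs_lex) = π_q(ρ_2(m_alt))`, and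
`L̃_q ∩ [0, m̃_q) = π_q(M^abs_lex) ∩ [0, m̃_q) = {0} ∪ {π_q(ρ_2((τ_{0,2}^n(0))^∞)) : n ≥ 0}`. -/
theorem stmt_19 (q : ℕ) (hq : 2 ≤ q)
    (mabs : W3) (hmabs : IsSmallestAcc lex3le (MAbs lex3le) mabs)
    (malt : W2) (hmalt : IsSmallestAcc altLe (supWords altLe) malt) :
    IsSmallestAccR (Ltilde q) (piBeta3 q mabs) ∧
    piBeta3 q mabs = piBeta3 q (rhoW par2 malt) ∧
    Ltilde q ∩ Set.Ico 0 (piBeta3 q mabs) =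
      (piBeta3 q '' MAbs lex3le) ∩ Set.Ico 0 (piBeta3 q mabs) ∧
    Ltilde q ∩ Set.Ico 0 (piBeta3 q mabs) =
      insert 0 {x | ∃ n : ℕ, x = piBeta3 q (rhoW par2 (perW (tauIter02 n)))} := by
  have hβ : (2 : ℝ) ≤ q := by exact_mod_cast hq
  obtain rfl := eq_tauFix_of_isSmallestAcc hmalt
  obtain rfl := eq_rho_tauFix_of_isSmallestAcc hmabs
  have hclass : ∀ m, AbsMax m → piBeta3 q m < piBeta3 q (rho tauFix) →
      piBeta3 q m = 0 ∨ ∃ n, piBeta3 q m = piBeta3 q (rho (tauPow n)) := by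
    intro m hm hlt
    rcases hm.eq_or_exists_eq hβ hlt with rfl | ⟨n, rfl⟩
    · exact Or.inl piBeta3_zeroW3
    · exact Or.inr ⟨n, rfl⟩
  have hL : ∀ r ∈ Ltilde q, r < piBeta3 q (rho tauFix) → ∃ y, AbsMax y ∧ piBeta3 q y = r :=
    fun r hr hlt => exists_absMax_of_mem_Ltilde hq hr (hlt.trans (piBeta3_rho_lt hβ _))
  have hL' : ∀ r ∈ Ltilde q, r < piBeta3 q (rho tauFix) →
      r = 0 ∨ ∃ n, r = piBeta3 q (rho (tauPow n)) := by
    intro r hr hlt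
    obtain ⟨y, hy, rfl⟩ := hL r hr hlt
    exact hclass y hy hlt
  have hmem : ∀ r, (r = 0 ∨ ∃ n, r = piBeta3 q (rho (tauPow n))) →
      r ∈ Ltilde q ∩ Set.Ico 0 (piBeta3 q (rho tauFix)) := by
    rintro r (rfl | ⟨n, rfl⟩)
    · exact ⟨zero_mem_Ltilde _, le_rfl, piBeta3_rho_pos hβ _⟩
    · exact ⟨piBeta3_rho_tauPow_mem_Ltilde hq n, (piBeta3_rho_pos hβ _).le,
        piBeta3_rho_strictMono hβ (tauPow_altLt_tauFix n)⟩
  refine ⟨?_, rfl, ?_, ?_⟩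
  · exact isSmallestAccR_of_tendsto ((lipWord_piBeta3_rho hβ).tendsto agree_tauPow_tauFix)
      (piBeta3_rho_tauPow_mem_Ltilde hq)
      (fun n => (piBeta3_rho_strictMono hβ (tauPow_altLt_tauFix n)).ne) hL'
  · refine Set.Subset.antisymm ?_ ?_
    · rintro r ⟨hr, hI⟩
      obtain ⟨y, hy, hyr⟩ := hL r hr hI.2
      exact ⟨⟨y, mem_MAbs_iff.2 hy, hyr⟩, hI⟩
    · rintro _ ⟨⟨m, hm, rfl⟩, hI⟩
      exact hmem _ (hclass m (mem_MAbs_iff.1 hm) hI.2)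
  · ext r
    simp only [Set.mem_insert_iff, Set.mem_ofPred_eq, ← tauPow_eq_perW]
    exact ⟨fun h => hL' r h.1 h.2.2, hmem r⟩
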